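/- (Müller's higher integrability of nonnegative Jacobians) Let n ≥ 2, let Ω ⊂ ℝⁿ be a bounded open set, let ω ⊂ Ω be compact, and let M > 0. Then there exists a constant C > 0, depending only on n, Ω, ω, and M, such that for every continuously differentiable map u : Ω → ℝⁿ with ∫_Ω (|u(x)|ⁿ + |∇u(x)|ⁿ) dx ≤ Mⁿ and det ∇u(x) ≥ 0 for all x ∈ Ω, one has ∫_ω det ∇u(x) · log(2 + det ∇u(x)) dx ≤ C. -/

import Mathlib

open MeasureTheory Filter Topology Metric Bornology
open scoped ENNReal NNReal

noncomputable section

/-- The gradient of a map `u : ℝⁿ → ℝⁿ`, identified with an `n × n` matrix. -/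
def grad {n : ℕ} (u : EuclideanSpace ℝ (Fin n) → EuclideanSpace ℝ (Fin n))
    (x : EuclideanSpace ℝ (Fin n)) : Matrix (Fin n) (Fin n) ℝ :=
  Matrix.of fun i j => fderiv ℝ u x (EuclideanSpace.single j 1) i

/-- The Frobenius norm of a matrix. -/
def frob {m n : ℕ} (A : Matrix (Fin m) (Fin n) ℝ) : ℝ :=
  Real.sqrt (∑ i, ∑ j, (A i j) ^ 2)


/-- The matrix of a continuous linear map in the standard basis. -/
def mat {n : ℕ} (A : EuclideanSpace ℝ (Fin n) →L[ℝ] EuclideanSpace ℝ (Fin n)) :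
    Matrix (Fin n) (Fin n) ℝ :=
  Matrix.of fun i j => A (EuclideanSpace.single j 1) i

lemma mat_eq {n : ℕ} (A : EuclideanSpace ℝ (Fin n) →L[ℝ] EuclideanSpace ℝ (Fin n)) :
    mat A = LinearMap.toMatrix (EuclideanSpace.basisFun (Fin n) ℝ).toBasis
      (EuclideanSpace.basisFun (Fin n) ℝ).toBasis (A : EuclideanSpace ℝ (Fin n) →ₗ[ℝ] EuclideanSpace ℝ (Fin n)) := by
  ext i j
  simp [mat, LinearMap.toMatrix_apply]

lemma mat_det {n : ℕ} (A : EuclideanSpace ℝ (Fin n) →L[ℝ] EuclideanSpace ℝ (Fin n)) :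
    (mat A).det = A.det := by
  rw [mat_eq, LinearMap.det_toMatrix]

lemma grad_eq_mat {n : ℕ} (u : EuclideanSpace ℝ (Fin n) → EuclideanSpace ℝ (Fin n))
    (x : EuclideanSpace ℝ (Fin n)) : grad u x = mat (fderiv ℝ u x) := rfl

lemma grad_det {n : ℕ} (u : EuclideanSpace ℝ (Fin n) → EuclideanSpace ℝ (Fin n))
    (x : EuclideanSpace ℝ (Fin n)) : (grad u x).det = (fderiv ℝ u x).det := mat_det _

lemma mat_one_add {n : ℕ} (A : EuclideanSpace ℝ (Fin n) →L[ℝ] EuclideanSpace ℝ (Fin n)) (t : ℝ) :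
    mat (ContinuousLinearMap.id ℝ _ + t • A) = t • mat A + 1 := by
  ext i j
  simp [mat, Matrix.one_apply, add_comm]

/-- Lagrange extraction of the leading coefficient of `t ↦ det (1 + t A)`. -/
lemma det_lagrange {n : ℕ} (e : ℕ → ℝ) (he : Function.Injective e)
    (A : EuclideanSpace ℝ (Fin n) →L[ℝ] EuclideanSpace ℝ (Fin n)) :
    A.det = ∑ i ∈ Finset.range (n + 1), (ContinuousLinearMap.id ℝ _ + e i • A).det /
      ∏ j ∈ (Finset.range (n + 1)).erase i, (e i - e j) := by
  set P : Polynomial ℝ := Matrix.det ((Polynomial.X : Polynomial ℝ) • (mat A).map Polynomial.C +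
    (1 : Matrix (Fin n) (Fin n) ℝ).map Polynomial.C) with hP
  have hdeg : P.natDegree ≤ n := by
    have := Polynomial.natDegree_det_X_add_C_le (mat A) 1
    rwa [Fintype.card_fin] at this
  have hc : P.coeff n = (mat A).det := by
    have := Polynomial.coeff_det_X_add_C_card (mat A) 1
    rwa [Fintype.card_fin] at this
  have hev : ∀ t : ℝ, P.eval t = (ContinuousLinearMap.id ℝ _ + t • A).det := by
    intro t
    rw [← mat_det, mat_one_add, hP]
    change Polynomial.evalRingHom t _ = _
    rw [RingHom.map_det]
    congr 1
    ext i j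
    simp [Matrix.one_apply]
    split_ifs <;> simp [mul_comm]
  have := Lagrange.coeff_eq_sum (s := Finset.range (n+1)) (v := e) (he.injOn) (P := P) (by
    rw [Finset.card_range]
    exact lt_of_le_of_lt Polynomial.degree_le_natDegree (by exact_mod_cast Nat.lt_succ_of_le hdeg))
  rw [Finset.card_range, Nat.add_sub_cancel, hc, mat_det] at this
  rw [this]
  simp_rw [hev]

/-- A vector-valued Lipschitz map vanishing on `s` has vanishing derivative a.e. on `s`. -/
lemma fderiv_zero_ae {n : ℕ} {z : EuclideanSpace ℝ (Fin n) → EuclideanSpace ℝ (Fin n)} {K : ℝ≥0}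
    (hz : LipschitzWith K z) {s : Set (EuclideanSpace ℝ (Fin n))} (hs : MeasurableSet s)
    (h0 : ∀ x ∈ s, z x = 0) : ∀ᵐ x ∂(volume.restrict s), fderiv ℝ z x = 0 := by
  have hD : MeasurableSet {x | DifferentiableAt ℝ z x} := measurableSet_of_differentiableAt ℝ z
  have key := ApproximatesLinearOn.norm_fderiv_sub_le (μ := volume) (f := z)
    (s := s ∩ {x | DifferentiableAt ℝ z x}) (A := 0) (δ := 0)
    (by
      intro x hx y hy
      simp [h0 x hx.1, h0 y hy.1]) (hs.inter hD) (fderiv ℝ z)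
    (fun x hx => hx.2.hasFDerivAt.hasFDerivWithinAt)
  rw [ae_restrict_iff' (hs.inter hD)] at key
  rw [ae_restrict_iff' hs]
  filter_upwards [key, hz.ae_differentiableAt (μ := volume)] with x hx hd hxs
  have := hx ⟨hxs, hd⟩
  simpa using this

lemma lipschitz_image_null {n : ℕ} {F : EuclideanSpace ℝ (Fin n) → EuclideanSpace ℝ (Fin n)} {K : ℝ≥0}
    (hF : LipschitzWith K F) {N : Set (EuclideanSpace ℝ (Fin n))} (hN : volume N = 0) :
    volume (F '' N) = 0 := by
  have h1 : (volume : Measure (EuclideanSpace ℝ (Fin n))) ≪ Measure.hausdorffMeasure (n : ℝ) := by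
    have : (Measure.hausdorffMeasure (n : ℝ) : Measure (EuclideanSpace ℝ (Fin n))).IsAddHaarMeasure := by
      simpa using MeasureTheory.isAddHaarMeasure_hausdorffMeasure (E := EuclideanSpace ℝ (Fin n))
    exact Measure.absolutelyContinuous_isAddHaarMeasure _ _
  have h2 : (Measure.hausdorffMeasure (n : ℝ) : Measure (EuclideanSpace ℝ (Fin n))) ≪ volume := by
    have : (Measure.hausdorffMeasure (n : ℝ) : Measure (EuclideanSpace ℝ (Fin n))).IsAddHaarMeasure := by
      simpa using MeasureTheory.isAddHaarMeasure_hausdorffMeasure (E := EuclideanSpace ℝ (Fin n))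
    exact Measure.absolutelyContinuous_isAddHaarMeasure _ _
  apply h1
  have := (hF.lipschitzOnWith (s := N)).hausdorffMeasure_image_le (d := (n:ℝ)) (by positivity)
  rw [h2 hN, mul_zero] at this
  exact le_antisymm this bot_le

lemma exists_det_pos (n : ℕ) : ∃ δ > 0, ∀ A : EuclideanSpace ℝ (Fin n) →L[ℝ] EuclideanSpace ℝ (Fin n),
    ‖A‖ < δ → 0 < (ContinuousLinearMap.id ℝ _ + A).det := by
  have hc : Continuous fun A : EuclideanSpace ℝ (Fin n) →L[ℝ] EuclideanSpace ℝ (Fin n) =>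
    (ContinuousLinearMap.id ℝ _ + A).det :=
    ContinuousLinearMap.continuous_det.comp (continuous_const.add continuous_id)
  have h0 : (0:ℝ) < (ContinuousLinearMap.id ℝ (EuclideanSpace ℝ (Fin n)) + 0).det := by
    rw [add_zero]
    have : (ContinuousLinearMap.id ℝ (EuclideanSpace ℝ (Fin n))).det = 1 := by
      simp [ContinuousLinearMap.det]
    rw [this]; norm_num
  have := hc.continuousAt.eventually (lt_mem_nhds h0)
  obtain ⟨δ, hδ, h⟩ := Metric.eventually_nhds_iff.1 this
  exact ⟨δ, hδ, fun A hA => h (by simpa using hA)⟩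

lemma pert_integral {n : ℕ} {g : EuclideanSpace ℝ (Fin n) → EuclideanSpace ℝ (Fin n)}
    {K : ℝ≥0} (hg : LipschitzWith K g) {R : ℝ}
    (hsupp : ∀ x, x ∉ ball (0 : EuclideanSpace ℝ (Fin n)) R → g x = 0)
    {t : ℝ} (ht0 : |t| * K < 1)
    (htd : ∀ x, 0 < (ContinuousLinearMap.id ℝ _ + t • fderiv ℝ g x).det) :
    ∫⁻ x in ball (0 : EuclideanSpace ℝ (Fin n)) R,
      ENNReal.ofReal ((ContinuousLinearMap.id ℝ _ + t • fderiv ℝ g x).det)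
      = volume (ball (0 : EuclideanSpace ℝ (Fin n)) R) := by
  set B := ball (0 : EuclideanSpace ℝ (Fin n)) R
  set F : EuclideanSpace ℝ (Fin n) → EuclideanSpace ℝ (Fin n) := fun x => x + t • g x with hF
  set c : ℝ≥0 := ‖t‖₊ * K with hc
  have hcr : (c : ℝ) = |t| * K := by simp [hc]
  have hc1 : c < 1 := by
    rw [← NNReal.coe_lt_coe, hcr]; simpa using ht0
  have happ : ApproximatesLinearOn F
      ((ContinuousLinearEquiv.refl ℝ (EuclideanSpace ℝ (Fin n)) :
        EuclideanSpace ℝ (Fin n) ≃L[ℝ] EuclideanSpace ℝ (Fin n)) :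
        EuclideanSpace ℝ (Fin n) →L[ℝ] EuclideanSpace ℝ (Fin n)) Set.univ c := by
    intro x _ y _
    have h1 : F x - F y - (x - y) = t • (g x - g y) := by simp [hF, smul_sub]; abel
    have h2 := hg.dist_le_mul x y
    rw [dist_eq_norm, dist_eq_norm] at h2
    have h3 : ‖F x - F y - (x - y)‖ ≤ |t| * (K * ‖x - y‖) := by
      rw [h1, norm_smul, Real.norm_eq_abs]
      gcongr
    rw [hcr, mul_assoc]; exact h3
  have hbij : Function.Bijective F := by
    have hh : Subsingleton (EuclideanSpace ℝ (Fin n)) ∨ c < ‖((ContinuousLinearEquiv.refl ℝ (EuclideanSpace ℝ (Fin n))).symm : EuclideanSpace ℝ (Fin n) →L[ℝ] EuclideanSpace ℝ (Fin n))‖₊⁻¹ := by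
      rcases subsingleton_or_nontrivial (EuclideanSpace ℝ (Fin n)) with h | h
      · exact Or.inl h
      · right
        have : ‖((ContinuousLinearEquiv.refl ℝ (EuclideanSpace ℝ (Fin n))).symm : EuclideanSpace ℝ (Fin n) →L[ℝ] EuclideanSpace ℝ (Fin n))‖₊ = 1 := by
          ext
          simp
        rw [this]; simpa using hc1
    exact (happ.toHomeomorph F hh).bijective
  have hout : ∀ x, x ∉ B → F x = x := by
    intro x hx; simp [hF, hsupp x hx]
  have himg : F '' B = B := by
    ext y
    constructor
    · rintro ⟨x, hx, rfl⟩
      by_contra h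
      have := hbij.1 (hout _ h)
      rw [this] at h
      exact h hx
    · intro hy
      obtain ⟨x, rfl⟩ := hbij.2 y
      refine ⟨x, ?_, rfl⟩
      by_contra h
      rw [hout x h] at hy
      exact h hy
  have hFl : LipschitzWith (1 + c) F := by
    refine LipschitzWith.id.add ?_
    exact (lipschitzWith_smul t).comp hg |>.weaken (by simp [hc])
  set D := {x | DifferentiableAt ℝ g x} with hD
  have hDm : MeasurableSet D := measurableSet_of_differentiableAt ℝ g
  have hDae : ∀ᵐ x, x ∈ D := hg.ae_differentiableAt
  have hnull : volume Dᶜ = 0 := by rw [ae_iff] at hDae; exact hDae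
  have hcov := lintegral_abs_det_fderiv_eq_addHaar_image volume (f := F)
    (f' := fun x => ContinuousLinearMap.id ℝ _ + t • fderiv ℝ g x) (s := B ∩ D)
    (measurableSet_ball.inter hDm)
    (fun x hx => ((hasFDerivAt_id x).add (hx.2.hasFDerivAt.const_smul t)).hasFDerivWithinAt)
    hbij.1.injOn
  have h1 : volume (F '' (B ∩ D)) = volume B := by
    apply le_antisymm
    · calc _ ≤ volume (F '' B) := measure_mono (Set.image_mono Set.inter_subset_left)
        _ = _ := by rw [himg]
    · calc volume B = volume (F '' B) := by rw [himg]
        _ ≤ volume (F '' (B ∩ D) ∪ F '' Dᶜ) := by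
          apply measure_mono
          rw [← Set.image_union]
          apply Set.image_mono
          intro x hx
          by_cases h : x ∈ D
          · exact Or.inl ⟨hx, h⟩
          · exact Or.inr h
        _ ≤ volume (F '' (B ∩ D)) + volume (F '' Dᶜ) := measure_union_le _ _
        _ = _ := by rw [lipschitz_image_null hFl hnull, add_zero]
  rw [h1] at hcov
  rw [← hcov]
  rw [Measure.restrict_congr_set (s := B) (t := B ∩ D)]
  · apply lintegral_congr
    intro x
    rw [abs_of_pos (htd x)]
  · have := hDae
    filter_upwards [this] with x hx
    apply propext
    exact ⟨fun h => ⟨h, hx⟩, fun h => h.1⟩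

/-- Jacobians are null Lagrangians: compactly supported Lipschitz maps have Jacobian of mean zero. -/
lemma integral_det_eq_zero {n : ℕ} (hn : 1 ≤ n)
    {g : EuclideanSpace ℝ (Fin n) → EuclideanSpace ℝ (Fin n)}
    {K : ℝ≥0} (hg : LipschitzWith K g) (hsupp : HasCompactSupport g) :
    ∫ x, (fderiv ℝ g x).det = 0 := by
  have : Nonempty (Fin n) := ⟨⟨0, hn⟩⟩
  obtain ⟨R, hR⟩ := hsupp.isCompact.isBounded.subset_ball (0 : EuclideanSpace ℝ (Fin n))
  have hz : ∀ x, x ∉ ball (0 : EuclideanSpace ℝ (Fin n)) R → fderiv ℝ g x = 0 := by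
    intro x hx
    exact fderiv_of_notMem_tsupport ℝ (fun h => hx (hR h))
  have hz' : ∀ x, x ∉ ball (0 : EuclideanSpace ℝ (Fin n)) R → g x = 0 := by
    intro x hx
    exact image_eq_zero_of_notMem_tsupport (fun h => hx (hR h))
  rw [← setIntegral_eq_integral_of_forall_compl_eq_zero
    (s := ball (0 : EuclideanSpace ℝ (Fin n)) R) (by
      intro x hx
      rw [hz x hx]
      simp [ContinuousLinearMap.det] <;> omega)]
  obtain ⟨δ, hδ, hdet⟩ := exists_det_pos n
  set e0 : ℝ := min δ 1 / (2 * (K + 1)) with he0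
  have he0p : 0 < e0 := by positivity
  have he0K : e0 * (K + 1) = min δ 1 / 2 := by rw [he0]; field_simp
  set e : ℕ → ℝ := fun i => e0 / (i + 1) with hedef
  have hei : Function.Injective e := by
    intro i j hij
    simp only [hedef] at hij
    have hi : (i : ℝ) + 1 ≠ 0 := by positivity
    have hj : (j : ℝ) + 1 ≠ 0 := by positivity
    rw [div_eq_div_iff hi hj] at hij
    have := mul_left_cancel₀ he0p.ne' hij
    have h3 : (i : ℝ) = j := by linarith
    exact_mod_cast h3
  have hepos : ∀ i, 0 < e i := fun i => by simp only [hedef]; positivity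
  have hele : ∀ i, e i ≤ e0 := fun i => by
    simp only [hedef]
    apply div_le_self he0p.le
    have : (0:ℝ) ≤ i := by positivity
    linarith
  have hek : ∀ i, e i * K < min δ 1 := by
    intro i
    have h1 : e i * K ≤ e0 * (K + 1) := by
      apply mul_le_mul (hele i) (by linarith) (by positivity) he0p.le
    have h2 : 0 < min δ 1 := by positivity
    linarith
  have hpos : ∀ i x, 0 < (ContinuousLinearMap.id ℝ _ + e i • fderiv ℝ g x).det := by
    intro i x
    apply hdet
    rw [norm_smul, Real.norm_eq_abs, abs_of_pos (hepos i)]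
    have h1 : ‖fderiv ℝ g x‖ ≤ K := norm_fderiv_le_of_lipschitz ℝ hg
    calc e i * ‖fderiv ℝ g x‖ ≤ e i * K := by
          apply mul_le_mul_of_nonneg_left h1 (hepos i).le
      _ < min δ 1 := hek i
      _ ≤ δ := min_le_left _ _
  have hIntBd := fun i => pert_integral hg hz' (t := e i) (by
    rw [abs_of_pos (hepos i)]; exact (hek i).trans_le (min_le_right _ _)) (hpos i)
  have hmeas : ∀ i, Measurable fun x => (ContinuousLinearMap.id ℝ _ + e i • fderiv ℝ g x).det := by
    intro i
    exact ContinuousLinearMap.continuous_det.measurable.comp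
      (((measurable_fderiv ℝ g).const_smul (e i)).const_add _)
  have hinteg : ∀ i, IntegrableOn (fun x => (ContinuousLinearMap.id ℝ _ + e i • fderiv ℝ g x).det)
      (ball (0 : EuclideanSpace ℝ (Fin n)) R) := by
    intro i
    refine ⟨(hmeas i).aestronglyMeasurable, ?_⟩
    rw [hasFiniteIntegral_iff_ofReal (Eventually.of_forall fun x => (hpos i x).le), hIntBd i]
    exact measure_ball_lt_top
  have hval : ∀ i, ∫ x in ball (0 : EuclideanSpace ℝ (Fin n)) R,
      (ContinuousLinearMap.id ℝ _ + e i • fderiv ℝ g x).det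
      = (volume (ball (0 : EuclideanSpace ℝ (Fin n)) R)).toReal := by
    intro i
    rw [integral_eq_lintegral_of_nonneg_ae (Eventually.of_forall fun x => (hpos i x).le)
      (hmeas i).aestronglyMeasurable, hIntBd i]
  have hl : ∀ x, (fderiv ℝ g x).det = ∑ i ∈ Finset.range (n + 1), (ContinuousLinearMap.id ℝ _ + e i • fderiv ℝ g x).det /
      ∏ j ∈ (Finset.range (n + 1)).erase i, (e i - e j) := fun x => det_lagrange e hei (fderiv ℝ g x)
  simp_rw [hl]
  rw [integral_finsetSum _ (fun i _ => (hinteg i).div_const _)]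
  have hl2 : ∀ i (c : ℝ), ∫ x in ball (0 : EuclideanSpace ℝ (Fin n)) R,
      (ContinuousLinearMap.id ℝ _ + e i • fderiv ℝ g x).det / c
      = (volume (ball (0 : EuclideanSpace ℝ (Fin n)) R)).toReal / c := by
    intro i c
    rw [integral_div, hval]
  simp_rw [hl2]
  have h0 := det_lagrange (n := n) e hei 0
  have hz0 : ∀ i, (ContinuousLinearMap.id ℝ (EuclideanSpace ℝ (Fin n)) +
      e i • (0 : EuclideanSpace ℝ (Fin n) →L[ℝ] EuclideanSpace ℝ (Fin n)))
      = ContinuousLinearMap.id ℝ (EuclideanSpace ℝ (Fin n)) := by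
    intro i; ext x; simp
  simp_rw [hz0] at h0
  have hid : (ContinuousLinearMap.id ℝ (EuclideanSpace ℝ (Fin n))).det = 1 := by
    simp [ContinuousLinearMap.det]
  have h00 : (0 : EuclideanSpace ℝ (Fin n) →L[ℝ] EuclideanSpace ℝ (Fin n)).det = 0 := by
    simp [ContinuousLinearMap.det] <;> omega
  rw [hid, h00] at h0
  calc _ = (volume (ball (0 : EuclideanSpace ℝ (Fin n)) R)).toReal *
      ∑ i ∈ Finset.range (n + 1), 1 / ∏ j ∈ (Finset.range (n + 1)).erase i, (e i - e j) := by
        rw [Finset.mul_sum]; simp [div_eq_mul_inv]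
    _ = 0 := by rw [← h0, mul_zero]

/-- Dyadic, centred, local Hardy–Littlewood maximal function. -/
def hlMax {n : ℕ} (H : EuclideanSpace ℝ (Fin n) → ℝ≥0∞) (x : EuclideanSpace ℝ (Fin n)) : ℝ≥0∞ :=
  ⨆ k : ℕ, (∫⁻ y in closedBall x ((1 / 2 : ℝ) ^ k), H y) / volume (closedBall x ((1 / 2 : ℝ) ^ k))

lemma measurable_hlMax {n : ℕ} {H : EuclideanSpace ℝ (Fin n) → ℝ≥0∞} (hH : Measurable H) :
    Measurable (hlMax H) := by
  refine Measurable.iSup fun k => ?_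
  have h1 : ∀ x : EuclideanSpace ℝ (Fin n), volume (closedBall x ((1 / 2 : ℝ) ^ k))
      = volume (closedBall (0 : EuclideanSpace ℝ (Fin n)) ((1 / 2 : ℝ) ^ k)) := by
    intro x; exact Measure.addHaar_closedBall_center _ _ _
  simp_rw [h1]
  refine Measurable.div_const ?_ _
  have h2 : ∀ x : EuclideanSpace ℝ (Fin n), ∫⁻ y in closedBall x ((1 / 2 : ℝ) ^ k), H y
      = ∫⁻ y, ({p : EuclideanSpace ℝ (Fin n) × EuclideanSpace ℝ (Fin n) |
        dist p.2 p.1 ≤ (1 / 2 : ℝ) ^ k}.indicator (fun p => H p.2)) (x, y) := by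
    intro x
    rw [← lintegral_indicator measurableSet_closedBall]
    rfl
  simp_rw [h2]
  apply Measurable.lintegral_prod_right
  apply Measurable.indicator (by fun_prop)
  exact measurableSet_le (by fun_prop) (by fun_prop)

lemma hlMax_weak {n : ℕ} {H : EuclideanSpace ℝ (Fin n) → ℝ≥0∞} (hH : Measurable H)
    {a : ℝ≥0∞} (ha0 : a ≠ 0) (hat : a ≠ ⊤) :
    a * volume {x | a < hlMax H x} ≤ 2 * 5 ^ n * ∫⁻ x in {x | a / 2 < H x}, H x := by
  set S := {x | a < hlMax H x} with hS
  set T := {x | a / 2 < H x} with hT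
  have hTm : MeasurableSet T := measurableSet_lt measurable_const hH
  have hsel : ∀ x ∈ S, ∃ k : ℕ, a * volume (closedBall x ((1 / 2 : ℝ) ^ k)) ≤
      2 * ∫⁻ y in closedBall x ((1 / 2 : ℝ) ^ k) ∩ T, H y := by
    intro x hx
    obtain ⟨k, hk⟩ := lt_iSup_iff.1 (show a < hlMax H x from hx)
    refine ⟨k, ?_⟩
    set B := closedBall x ((1 / 2 : ℝ) ^ k)
    have hBt : volume B ≠ ⊤ := measure_closedBall_lt_top.ne
    have hB0 : volume B ≠ 0 := (measure_closedBall_pos volume x (by positivity)).ne'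
    have h1 : a * volume B ≤ ∫⁻ y in B, H y := by
      have := (ENNReal.le_div_iff_mul_le (Or.inl hB0) (Or.inl hBt)).1 hk.le
      exact this
    have h2 : ∫⁻ y in B, H y ≤ a / 2 * volume B + ∫⁻ y in B ∩ T, H y := by
      rw [← lintegral_inter_add_sdiff H B hTm, add_comm]
      gcongr
      calc ∫⁻ y in B \ T, H y ≤ ∫⁻ y in B \ T, a / 2 := by
            apply setLIntegral_mono measurable_const
            intro y hy
            exact not_lt.1 hy.2
        _ = a / 2 * volume (B \ T) := by rw [setLIntegral_const]
        _ ≤ _ := by gcongr; exact Set.sdiff_subset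
    have h3 : a * volume B = a / 2 * volume B + a / 2 * volume B := by
      rw [← add_mul, ENNReal.add_halves]
    have h4 : a / 2 * volume B ≠ ⊤ := ENNReal.mul_ne_top (by simp [ENNReal.div_eq_top, hat]) hBt
    have h5 : a / 2 * volume B ≤ ∫⁻ y in B ∩ T, H y := by
      have := h1.trans h2
      rw [h3] at this
      exact (ENNReal.add_le_add_iff_left h4).1 this
    rw [h3, two_mul]
    gcongr
  choose! k hk using hsel
  obtain ⟨u, huS, hdisj, hcov⟩ := Vitali.exists_disjoint_subfamily_covering_enlargement_closedBall
    S (fun x => x) (fun x => (1 / 2 : ℝ) ^ (k x)) 1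
    (fun x _ => pow_le_one₀ (by norm_num) (by norm_num)) 5 (by norm_num)
  have hucount : u.Countable := by
    apply hdisj.countable_of_nonempty_interior
    intro x _
    have : ball x ((1 / 2 : ℝ) ^ (k x)) ⊆ interior (closedBall x ((1 / 2 : ℝ) ^ (k x))) :=
      ball_subset_interior_closedBall
    exact ⟨x, this (mem_ball_self (by positivity))⟩
  have hSsub : S ⊆ ⋃ b ∈ u, closedBall b (5 * (1 / 2 : ℝ) ^ (k b)) := by
    intro x hx
    obtain ⟨b, hb, hsub⟩ := hcov x hx
    exact Set.mem_biUnion hb (hsub (mem_closedBall_self (by positivity)))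
  have hvol : ∀ b : EuclideanSpace ℝ (Fin n), volume (closedBall b (5 * (1 / 2 : ℝ) ^ (k b)))
      = 5 ^ n * volume (closedBall b ((1 / 2 : ℝ) ^ (k b))) := by
    intro b
    rw [Measure.addHaar_closedBall _ _ (by positivity), Measure.addHaar_closedBall _ _ (by positivity)]
    rw [finrank_euclideanSpace_fin, mul_pow, ENNReal.ofReal_mul (by positivity), ← mul_assoc]
    congr 2
    rw [ENNReal.ofReal_pow (by norm_num)]
    simp
  calc a * volume S ≤ a * ∑' b : u, volume (closedBall (b : EuclideanSpace ℝ (Fin n)) (5 * (1 / 2 : ℝ) ^ (k b))) := by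
        gcongr
        exact (measure_mono hSsub).trans (measure_biUnion_le _ hucount _)
    _ = ∑' b : u, 5 ^ n * (a * volume (closedBall (b : EuclideanSpace ℝ (Fin n)) ((1 / 2 : ℝ) ^ (k b)))) := by
        rw [← ENNReal.tsum_mul_left]
        congr 1; ext b
        rw [hvol]; ring
    _ ≤ ∑' b : u, 5 ^ n * (2 * ∫⁻ y in closedBall (b : EuclideanSpace ℝ (Fin n)) ((1 / 2 : ℝ) ^ (k b)) ∩ T, H y) := by
        refine ENNReal.tsum_le_tsum fun b => ?_
        exact mul_le_mul_right (hk b (huS b.2)) _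
    _ = 2 * 5 ^ n * ∑' b : u, ∫⁻ y in closedBall (b : EuclideanSpace ℝ (Fin n)) ((1 / 2 : ℝ) ^ (k b)) ∩ T, H y := by
        rw [← ENNReal.tsum_mul_left]
        congr 1; ext b; ring
    _ = 2 * 5 ^ n * ∫⁻ y in ⋃ b ∈ u, (closedBall (b : EuclideanSpace ℝ (Fin n)) ((1 / 2 : ℝ) ^ (k b)) ∩ T), H y := by
        rw [lintegral_biUnion hucount]
        · intro b _; exact measurableSet_closedBall.inter hTm
        · exact hdisj.mono fun b => Set.inter_subset_left
    _ ≤ _ := by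
        gcongr
        exact Set.iUnion₂_subset fun b _ => Set.inter_subset_right

/-- Strong type `(n,n)` bound. -/
lemma hlMax_strong {n : ℕ} (hn : 2 ≤ n) {h : EuclideanSpace ℝ (Fin n) → ℝ} (hm : Measurable h)
    (h0 : ∀ x, 0 ≤ h x) (hfin : ∀ x, hlMax (fun y => ENNReal.ofReal (h y)) x ≠ ⊤) :
    ∫⁻ x, ENNReal.ofReal ((hlMax (fun y => ENNReal.ofReal (h y)) x).toReal ^ n) ≤
      ENNReal.ofReal (n * 2 * 5 ^ n * 2 ^ (n - 1)) * ∫⁻ x, ENNReal.ofReal (h x ^ n) := by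
  set H : EuclideanSpace ℝ (Fin n) → ℝ≥0∞ := fun y => ENNReal.ofReal (h y) with hH
  have hHm : Measurable H := hm.ennreal_ofReal
  have hMm := measurable_hlMax hHm
  have hlc := lintegral_rpow_eq_lintegral_meas_lt_mul (volume : Measure (EuclideanSpace ℝ (Fin n)))
    (f := fun x => (hlMax H x).toReal) (Eventually.of_forall fun x => ENNReal.toReal_nonneg)
    hMm.ennreal_toReal.aemeasurable (p := n) (by positivity)
  simp only [Real.rpow_natCast] at hlc
  rw [hlc]
  have hstep : ∀ t ∈ Set.Ioi (0:ℝ), volume {a | t < (hlMax H a).toReal} * ENNReal.ofReal (t ^ ((n:ℝ) - 1))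
      ≤ ENNReal.ofReal (2 * 5 ^ n) * ∫⁻ x, (if t < 2 * h x then ENNReal.ofReal (h x * t ^ (n - 2)) else 0) := by
    intro t ht
    have ht : 0 < t := ht
    have hset : {a | t < (hlMax H a).toReal} = {a | ENNReal.ofReal t < hlMax H a} := by
      ext a
      exact (ENNReal.ofReal_lt_iff_lt_toReal ht.le (hfin a)).symm
    have hpow : t ^ ((n:ℝ) - 1) = t * t ^ (n - 2) := by
      rw [← pow_succ', ← Real.rpow_natCast]
      congr 1
      have : n - 2 + 1 = n - 1 := by omega
      rw [this, Nat.cast_sub (by omega)]; simp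
    rw [hset, hpow, ENNReal.ofReal_mul ht.le]
    have hw := hlMax_weak hHm (a := ENNReal.ofReal t) (by simpa using ht) ENNReal.ofReal_ne_top
    calc volume {a | ENNReal.ofReal t < hlMax H a} * (ENNReal.ofReal t * ENNReal.ofReal (t ^ (n - 2)))
        = (ENNReal.ofReal t * volume {a | ENNReal.ofReal t < hlMax H a}) * ENNReal.ofReal (t ^ (n - 2)) := by ring
      _ ≤ (2 * 5 ^ n * ∫⁻ x in {x | ENNReal.ofReal t / 2 < H x}, H x) * ENNReal.ofReal (t ^ (n - 2)) := by gcongr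
      _ = 2 * 5 ^ n * ∫⁻ x in {x | ENNReal.ofReal t / 2 < H x}, H x * ENNReal.ofReal (t ^ (n - 2)) := by
          rw [lintegral_mul_const _ hHm]; ring
      _ = _ := by
          congr 1
          · rw [ENNReal.ofReal_mul (by norm_num), ENNReal.ofReal_pow (by norm_num)]; simp
          · rw [← lintegral_indicator (measurableSet_lt measurable_const hHm)]
            apply lintegral_congr
            intro x
            have : (ENNReal.ofReal t / 2 < H x) ↔ t < 2 * h x := by
              have h2 : ENNReal.ofReal t / 2 = ENNReal.ofReal (t / 2) := by
                rw [ENNReal.ofReal_div_of_pos (by norm_num)]; simp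
              rw [h2, hH]
              simp only
              rw [ENNReal.ofReal_lt_ofReal_iff_of_nonneg (by positivity)]
              constructor <;> intro <;> linarith
            simp only [Set.indicator, Set.mem_ofPred_eq, this]
            split_ifs
            · rw [ENNReal.ofReal_mul (h0 x)]
            · rfl
  have hmeas2 : Measurable (Function.uncurry fun (t : ℝ) (x : EuclideanSpace ℝ (Fin n)) =>
      (if t < 2 * h x then ENNReal.ofReal (h x * t ^ (n - 2)) else 0)) := by
    unfold Function.uncurry
    apply Measurable.ite
    · exact measurableSet_lt measurable_fst (by fun_prop)
    · fun_prop
    · fun_prop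
  calc ENNReal.ofReal n * ∫⁻ t in Set.Ioi (0:ℝ), volume {a | t < (hlMax H a).toReal} * ENNReal.ofReal (t ^ ((n:ℝ) - 1))
      ≤ ENNReal.ofReal n * ∫⁻ t in Set.Ioi (0:ℝ), ENNReal.ofReal (2 * 5 ^ n) * ∫⁻ x, (if t < 2 * h x then ENNReal.ofReal (h x * t ^ (n - 2)) else 0) := by
        gcongr 1
        apply setLIntegral_mono' measurableSet_Ioi hstep
    _ = ENNReal.ofReal n * (ENNReal.ofReal (2 * 5 ^ n) * ∫⁻ x, ∫⁻ t in Set.Ioi (0:ℝ), (if t < 2 * h x then ENNReal.ofReal (h x * t ^ (n - 2)) else 0)) := by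
        rw [lintegral_const_mul' _ _ ENNReal.ofReal_ne_top]
        rw [lintegral_lintegral_swap hmeas2.aemeasurable]
    _ ≤ ENNReal.ofReal n * (ENNReal.ofReal (2 * 5 ^ n) * ∫⁻ x, ENNReal.ofReal (2 ^ (n - 1)) * ENNReal.ofReal (h x ^ n)) := by
        gcongr with x
        calc ∫⁻ t in Set.Ioi (0:ℝ), (if t < 2 * h x then ENNReal.ofReal (h x * t ^ (n - 2)) else 0)
            ≤ ∫⁻ t in Set.Ioi (0:ℝ), (Set.Ioo 0 (2 * h x)).indicator (fun _ => ENNReal.ofReal (h x * (2 * h x) ^ (n - 2))) t := by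
              apply setLIntegral_mono' measurableSet_Ioi
              intro t ht
              have ht : 0 < t := ht
              by_cases htt : t < 2 * h x
              · simp only [htt, if_true, Set.indicator, Set.mem_Ioo, ht, and_self]
                apply ENNReal.ofReal_le_ofReal
                have := h0 x
                gcongr
              · simp [htt]
          _ ≤ ∫⁻ t, (Set.Ioo 0 (2 * h x)).indicator (fun _ => ENNReal.ofReal (h x * (2 * h x) ^ (n - 2))) t :=
              setLIntegral_le_lintegral _ _
          _ = ENNReal.ofReal (h x * (2 * h x) ^ (n - 2)) * ENNReal.ofReal (2 * h x) := by
              rw [lintegral_indicator measurableSet_Ioo, setLIntegral_const, Real.volume_Ioo, sub_zero]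
          _ = _ := by
              have := h0 x
              rw [← ENNReal.ofReal_mul (by positivity), ← ENNReal.ofReal_mul (by positivity)]
              congr 1
              obtain ⟨m, rfl⟩ : ∃ m, n = m + 2 := ⟨n - 2, by omega⟩
              simp only [Nat.add_sub_cancel, show m + 2 - 1 = m + 1 from rfl]
              rw [mul_pow]; ring
    _ = _ := by
        rw [lintegral_const_mul' _ _ ENNReal.ofReal_ne_top, ← mul_assoc, ← mul_assoc,
          ← ENNReal.ofReal_mul (by positivity), ← ENNReal.ofReal_mul (by positivity)]
        congr 2
        ring

/-- The real valued maximal function used for the truncation. -/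
def vMax {n : ℕ} (h : EuclideanSpace ℝ (Fin n) → ℝ) (x : EuclideanSpace ℝ (Fin n)) : ℝ :=
  max (h x) (hlMax (fun y => ENNReal.ofReal (h y)) x).toReal

lemma hlMax_ne_top {n : ℕ} {h : EuclideanSpace ℝ (Fin n) → ℝ} {S : ℝ} (hS : ∀ x, h x ≤ S)
    (x : EuclideanSpace ℝ (Fin n)) : hlMax (fun y => ENNReal.ofReal (h y)) x ≠ ⊤ := by
  have : hlMax (fun y => ENNReal.ofReal (h y)) x ≤ ENNReal.ofReal S := by
    apply iSup_le
    intro k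
    apply ENNReal.div_le_of_le_mul
    rw [← setLIntegral_const]
    apply setLIntegral_mono measurable_const
    intro y _
    exact ENNReal.ofReal_le_ofReal (hS y)
  exact (this.trans_lt ENNReal.ofReal_lt_top).ne

lemma le_vMax {n : ℕ} (h : EuclideanSpace ℝ (Fin n) → ℝ) (x : EuclideanSpace ℝ (Fin n)) :
    h x ≤ vMax h x := le_max_left _ _

lemma measurable_vMax {n : ℕ} {h : EuclideanSpace ℝ (Fin n) → ℝ} (hm : Measurable h) :
    Measurable (vMax h) :=
  hm.max (measurable_hlMax hm.ennreal_ofReal).ennreal_toReal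

lemma vMax_avg {n : ℕ} {h : EuclideanSpace ℝ (Fin n) → ℝ} {S : ℝ} (hS : ∀ x, h x ≤ S)
    {x : EuclideanSpace ℝ (Fin n)} {l : ℝ} (hl : vMax h x ≤ l) (k : ℕ) :
    ∫⁻ y in closedBall x ((1 / 2 : ℝ) ^ k), ENNReal.ofReal (h y) ≤
      ENNReal.ofReal l * volume (closedBall x ((1 / 2 : ℝ) ^ k)) := by
  have h1 : hlMax (fun y => ENNReal.ofReal (h y)) x ≤ ENNReal.ofReal l := by
    rw [← ENNReal.ofReal_toReal (hlMax_ne_top hS x)]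
    exact ENNReal.ofReal_le_ofReal ((le_max_right _ _).trans hl)
  have h2 := (le_iSup (fun k : ℕ => (∫⁻ y in closedBall x ((1 / 2 : ℝ) ^ k), ENNReal.ofReal (h y)) /
    volume (closedBall x ((1 / 2 : ℝ) ^ k))) k).trans h1
  rwa [ENNReal.div_le_iff (measure_closedBall_pos volume x (by positivity)).ne'
    measure_closedBall_lt_top.ne] at h2

lemma vMax_strong {n : ℕ} (hn : 2 ≤ n) {h : EuclideanSpace ℝ (Fin n) → ℝ} (hm : Measurable h)
    (h0 : ∀ x, 0 ≤ h x) {S : ℝ} (hS : ∀ x, h x ≤ S) :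
    ∫⁻ x, ENNReal.ofReal (vMax h x ^ n) ≤
      ENNReal.ofReal (1 + n * 2 * 5 ^ n * 2 ^ (n - 1)) * ∫⁻ x, ENNReal.ofReal (h x ^ n) := by
  calc ∫⁻ x, ENNReal.ofReal (vMax h x ^ n)
      ≤ ∫⁻ x, (ENNReal.ofReal (h x ^ n) +
        ENNReal.ofReal ((hlMax (fun y => ENNReal.ofReal (h y)) x).toReal ^ n)) := by
        gcongr with x
        have ht : 0 ≤ (hlMax (fun y => ENNReal.ofReal (h y)) x).toReal := ENNReal.toReal_nonneg
        have := h0 x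
        rw [← ENNReal.ofReal_add (by positivity) (by positivity)]
        apply ENNReal.ofReal_le_ofReal
        unfold vMax
        rcases max_choice (h x) (hlMax (fun y => ENNReal.ofReal (h y)) x).toReal with h | h
        · rw [h]; have : 0 ≤ (hlMax (fun y => ENNReal.ofReal (_ : ℝ)) x).toReal ^ n := pow_nonneg ht n
          linarith
        · rw [h]; have := pow_nonneg this n
          linarith
    _ = _ := lintegral_add_left (by fun_prop) _
    _ ≤ _ := by
        rw [ENNReal.ofReal_add (by norm_num) (by positivity), add_mul, ENNReal.ofReal_one, one_mul]
        gcongr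
        exact hlMax_strong hn hm h0 (hlMax_ne_top hS)

lemma lintegral_homothety {n : ℕ} {G : EuclideanSpace ℝ (Fin n) → ℝ≥0∞} (hG : Measurable G)
    (x : EuclideanSpace ℝ (Fin n)) {t : ℝ} (ht : 0 < t) :
    ∫⁻ z, G (x + t • (z - x)) = ENNReal.ofReal ((t ^ n)⁻¹) * ∫⁻ z, G z := by
  have h1 : ∫⁻ z, G (x + t • (z - x)) = ∫⁻ z, G (x + t • z) :=
    lintegral_sub_right_eq_self (fun z => G (x + t • z)) x
  have h2 : ∫⁻ z, G (x + z) = ∫⁻ z, G z := lintegral_add_left_eq_self G x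
  rw [h1, ← h2]
  have h3 := Measure.map_addHaar_smul (volume : Measure (EuclideanSpace ℝ (Fin n))) ht.ne'
  rw [finrank_euclideanSpace_fin, abs_of_pos (by positivity)] at h3
  have h4 : ∫⁻ z, G (x + z) ∂(Measure.map (fun z => t • z) (volume : Measure (EuclideanSpace ℝ (Fin n))))
      = ∫⁻ z, G (x + t • z) := lintegral_map (by fun_prop) (by fun_prop)
  rw [← h4]
  change ∫⁻ z, G (x + z) ∂(Measure.map (t • ·) volume) = _
  rw [h3, lintegral_smul_measure, smul_eq_mul]

lemma vMax_avg' {n : ℕ} {h : EuclideanSpace ℝ (Fin n) → ℝ} {S : ℝ} (hS : ∀ x, h x ≤ S)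
    {x : EuclideanSpace ℝ (Fin n)} {l : ℝ} (hl0 : 0 ≤ l) (hl : vMax h x ≤ l) {s : ℝ} (hs : 0 < s) (hs1 : s ≤ 1) :
    ∫⁻ y in closedBall x s, ENNReal.ofReal (h y) ≤
      ENNReal.ofReal (l * 2 ^ n * s ^ n) * volume (ball (0 : EuclideanSpace ℝ (Fin n)) 1) := by
  obtain ⟨k, hk1, hk2⟩ := exists_nat_pow_near_of_lt_one hs hs1 (y := (1/2 : ℝ)) (by norm_num) (by norm_num)
  calc ∫⁻ y in closedBall x s, ENNReal.ofReal (h y)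
      ≤ ∫⁻ y in closedBall x ((1/2 : ℝ) ^ k), ENNReal.ofReal (h y) :=
        lintegral_mono_set (closedBall_subset_closedBall hk2)
    _ ≤ _ := vMax_avg hS hl k
    _ = ENNReal.ofReal (l * ((1/2 : ℝ) ^ k) ^ n) * volume (ball (0 : EuclideanSpace ℝ (Fin n)) 1) := by
        rw [Measure.addHaar_closedBall _ _ (by positivity), finrank_euclideanSpace_fin, ← mul_assoc,
          ← ENNReal.ofReal_mul hl0]
    _ ≤ _ := by
        rw [mul_assoc l, ← mul_pow]
        gcongr
        rw [pow_succ] at hk1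
        linarith

lemma half_est {n : ℕ} {h : EuclideanSpace ℝ (Fin n) → ℝ} {S : ℝ} (hS : ∀ x, h x ≤ S)
    (hm : Measurable h)
    {v : EuclideanSpace ℝ (Fin n) → ℝ} (hv : ContDiff ℝ 1 v) (hvh : ∀ x, ‖fderiv ℝ v x‖ ≤ h x)
    {x m : EuclideanSpace ℝ (Fin n)} {l : ℝ} (hl0 : 0 ≤ l) (hl : vMax h x ≤ l) {r : ℝ}
    (hr : 0 < r) (hr1 : r ≤ 1) (hmx : dist m x ≤ r / 2) :
    ∫⁻ z in closedBall m (r / 2), ENNReal.ofReal |v z - v x| ≤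
      ENNReal.ofReal (l * 4 ^ n * r) * volume (closedBall m (r / 2)) := by
  have hsub : closedBall m (r / 2) ⊆ closedBall x r := by
    apply closedBall_subset_closedBall'; linarith
  have hpt : ∀ z ∈ closedBall x r, ENNReal.ofReal |v z - v x| ≤
      ∫⁻ t in Set.Ioc (0:ℝ) 1, ENNReal.ofReal r * ENNReal.ofReal (h (x + t • (z - x))) := by
    intro z hz
    have hd : ∀ t : ℝ, HasDerivAt (fun t : ℝ => v (x + t • (z - x)))
        (fderiv ℝ v (x + t • (z - x)) (z - x)) t := by
      intro t
      have h1 : HasDerivAt (fun t : ℝ => x + t • (z - x)) (z - x) t := by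
        simpa using ((hasDerivAt_id t).smul_const (z - x)).const_add x
      exact ((hv.differentiable (by norm_num)) _).hasFDerivAt.comp_hasDerivAt t h1
    have h2 := enorm_sub_le_lintegral_deriv_of_contDiffOn_Icc
      (f := fun t : ℝ => v (x + t • (z - x))) (a := 0) (b := 1) (by fun_prop) (by norm_num)
    simp only [one_smul, zero_smul, add_zero, add_sub_cancel] at h2
    rw [Real.enorm_eq_ofReal_abs] at h2
    refine h2.trans ?_
    rw [← restrict_Ioc_eq_restrict_Icc]
    gcongr with t
    rw [(hd t).deriv, Real.enorm_eq_ofReal_abs, ← ENNReal.ofReal_mul hr.le]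
    apply ENNReal.ofReal_le_ofReal
    have h3 := (fderiv ℝ v (x + t • (z - x))).le_opNorm (z - x)
    rw [Real.norm_eq_abs] at h3
    have h4 : ‖z - x‖ ≤ r := by rw [← dist_eq_norm]; exact hz
    have h5 := hvh (x + t • (z - x))
    calc _ ≤ _ := h3
      _ ≤ h (x + t • (z - x)) * r := by
        gcongr
        exact (norm_nonneg _).trans h5
      _ = _ := mul_comm _ _
  have hmeas : Measurable (Function.uncurry fun (z : EuclideanSpace ℝ (Fin n)) (t : ℝ) =>
      ENNReal.ofReal r * ENNReal.ofReal (h (x + t • (z - x)))) := by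
    unfold Function.uncurry
    fun_prop
  have hin : ∀ t ∈ Set.Ioc (0:ℝ) 1, ∫⁻ z in closedBall x r, ENNReal.ofReal (h (x + t • (z - x)))
      ≤ ENNReal.ofReal (l * 2 ^ n * r ^ n) * volume (ball (0 : EuclideanSpace ℝ (Fin n)) 1) := by
    intro t ht
    have h1 : ∫⁻ z in closedBall x r, ENNReal.ofReal (h (x + t • (z - x)))
        = ∫⁻ z, ((closedBall x (t * r)).indicator (fun y => ENNReal.ofReal (h y))) (x + t • (z - x)) := by
      rw [← lintegral_indicator measurableSet_closedBall]
      apply lintegral_congr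
      intro z
      have : x + t • (z - x) ∈ closedBall x (t * r) ↔ z ∈ closedBall x r := by
        rw [mem_closedBall, mem_closedBall, dist_eq_norm, dist_eq_norm, add_sub_cancel_left, norm_smul,
          Real.norm_eq_abs, abs_of_pos ht.1]
        exact mul_le_mul_iff_right₀ ht.1
      by_cases hz : z ∈ closedBall x r
      · rw [Set.indicator_of_mem hz, Set.indicator_of_mem (this.2 hz)]
      · rw [Set.indicator_of_notMem hz, Set.indicator_of_notMem (fun h => hz (this.1 h))]
    have htp := ht.1
    rw [h1, lintegral_homothety (Measurable.indicator (by fun_prop) measurableSet_closedBall) x ht.1,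
      lintegral_indicator measurableSet_closedBall]
    calc _ ≤ ENNReal.ofReal ((t ^ n)⁻¹) * (ENNReal.ofReal (l * 2 ^ n * (t * r) ^ n) * volume (ball (0 : EuclideanSpace ℝ (Fin n)) 1)) := by
          gcongr
          exact vMax_avg' hS hl0 hl (by positivity) (mul_le_one₀ ht.2 hr.le hr1)
      _ = _ := by
          rw [← mul_assoc, ← ENNReal.ofReal_mul (by positivity)]
          congr 2
          rw [mul_pow]
          field_simp
  calc ∫⁻ z in closedBall m (r / 2), ENNReal.ofReal |v z - v x|
      ≤ ∫⁻ z in closedBall x r, ENNReal.ofReal |v z - v x| := lintegral_mono_set hsub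
    _ ≤ ∫⁻ z in closedBall x r, ∫⁻ t in Set.Ioc (0:ℝ) 1, ENNReal.ofReal r * ENNReal.ofReal (h (x + t • (z - x))) :=
        setLIntegral_mono' measurableSet_closedBall hpt
    _ = ∫⁻ t in Set.Ioc (0:ℝ) 1, ∫⁻ z in closedBall x r, ENNReal.ofReal r * ENNReal.ofReal (h (x + t • (z - x))) :=
        lintegral_lintegral_swap hmeas.aemeasurable
    _ ≤ ∫⁻ t in Set.Ioc (0:ℝ) 1, ENNReal.ofReal r * (ENNReal.ofReal (l * 2 ^ n * r ^ n) * volume (ball (0 : EuclideanSpace ℝ (Fin n)) 1)) := by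
        apply setLIntegral_mono' measurableSet_Ioc
        intro t ht
        rw [lintegral_const_mul' _ _ ENNReal.ofReal_ne_top]
        gcongr
        exact hin t ht
    _ = _ := by
        rw [setLIntegral_const, Real.volume_Ioc, Measure.addHaar_closedBall _ _ (by positivity),
          finrank_euclideanSpace_fin, ← mul_assoc, ← mul_assoc, ← ENNReal.ofReal_mul hr.le,
          ← ENNReal.ofReal_mul (by positivity)]
        simp only [sub_zero, ENNReal.ofReal_one, mul_one]
        congr 2
        rw [div_pow, show (4:ℝ) = 2 * 2 by norm_num, mul_pow]
        field_simp

/-- Pointwise Lipschitz estimate on sublevel sets of the maximal function. -/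
lemma lip_est {n : ℕ} {h : EuclideanSpace ℝ (Fin n) → ℝ} {S : ℝ} (hS : ∀ x, h x ≤ S)
    (hm : Measurable h)
    {v : EuclideanSpace ℝ (Fin n) → ℝ} (hv : ContDiff ℝ 1 v) (hvh : ∀ x, ‖fderiv ℝ v x‖ ≤ h x)
    (hvh0 : ∀ x, |v x| ≤ h x)
    {x y : EuclideanSpace ℝ (Fin n)} {l : ℝ} (hl0 : 0 ≤ l) (hx : vMax h x ≤ l) (hy : vMax h y ≤ l) :
    |v x - v y| ≤ 2 * 4 ^ n * l * dist x y := by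
  have h4 : (1:ℝ) ≤ 4 ^ n := one_le_pow₀ (by norm_num)
  rcases le_or_gt 1 (dist x y) with hd | hd
  · have h1 := (hvh0 x).trans ((le_vMax h x).trans hx)
    have h2 := (hvh0 y).trans ((le_vMax h y).trans hy)
    calc |v x - v y| ≤ |v x| + |v y| := abs_sub _ _
      _ ≤ 2 * 1 * l * 1 := by linarith
      _ ≤ _ := by gcongr
  rcases eq_or_lt_of_le (dist_nonneg (x := x) (y := y)) with h0 | h0
  · have := dist_eq_zero.1 h0.symm
    subst this
    simp
  set r := dist x y with hr
  set m := midpoint ℝ x y with hmdef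
  have e1 := half_est (m := m) hS hm hv hvh hl0 hx h0 hd.le (by
    rw [hmdef, dist_comm, dist_left_midpoint]; simp; linarith)
  have e2 := half_est (m := m) hS hm hv hvh hl0 hy h0 hd.le (by
    rw [hmdef, dist_midpoint_right]; simp; linarith)
  have hB0 : volume (closedBall m (r / 2)) ≠ 0 := (measure_closedBall_pos volume m (by positivity)).ne'
  have hBt : volume (closedBall m (r / 2)) ≠ ⊤ := measure_closedBall_lt_top.ne
  have e3 : ENNReal.ofReal |v x - v y| * volume (closedBall m (r / 2)) ≤
      ENNReal.ofReal (2 * 4 ^ n * l * r) * volume (closedBall m (r / 2)) := by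
    calc ENNReal.ofReal |v x - v y| * volume (closedBall m (r / 2))
        = ∫⁻ z in closedBall m (r / 2), ENNReal.ofReal |v x - v y| := by rw [setLIntegral_const]
      _ ≤ ∫⁻ z in closedBall m (r / 2), (ENNReal.ofReal |v z - v x| + ENNReal.ofReal |v z - v y|) := by
          gcongr with z
          rw [← ENNReal.ofReal_add (abs_nonneg _) (abs_nonneg _)]
          apply ENNReal.ofReal_le_ofReal
          rw [abs_sub_comm (v z) (v x)]
          exact abs_sub_le _ _ _
      _ = (∫⁻ z in closedBall m (r / 2), ENNReal.ofReal |v z - v x|) + ∫⁻ z in closedBall m (r / 2), ENNReal.ofReal |v z - v y| := by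
          apply lintegral_add_left
          have := hv.continuous.measurable
          fun_prop
      _ ≤ _ := add_le_add e1 e2
      _ = _ := by
          rw [← add_mul, ← ENNReal.ofReal_add (by positivity) (by positivity)]
          congr 2; ring
  rw [ENNReal.mul_le_mul_iff_left hB0 hBt] at e3
  exact (ENNReal.ofReal_le_ofReal_iff (by positivity)).1 e3

lemma det_row_bound {n : ℕ} (B : Matrix (Fin n) (Fin n) ℝ) (i0 : Fin n) {a b : ℝ}
    (ha : ∀ j, |B i0 j| ≤ a) (hb : ∀ i, i ≠ i0 → ∀ j, |B i j| ≤ b) :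
    |B.det| ≤ n.factorial * (a * b ^ (n - 1)) := by
  rw [Matrix.det_apply']
  set c : Fin n → ℝ := fun i => if i = i0 then a else b with hc
  have hBc : ∀ i j, |B i j| ≤ c i := by
    intro i j
    by_cases h : i = i0
    · simp only [hc, h, if_true]; exact ha j
    · simp only [hc, h, if_false]; exact hb i h j
  have hprod : ∏ i, c i = a * b ^ (n - 1) := by
    rw [← Finset.mul_prod_erase _ _ (Finset.mem_univ i0)]
    congr 1
    · simp [hc]
    · rw [Finset.prod_congr rfl (g := fun _ => b), Finset.prod_const,
        Finset.card_erase_of_mem (Finset.mem_univ _)]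
      · simp
      · intro i hi
        simp [hc, Finset.ne_of_mem_erase hi]
  calc _ ≤ ∑ σ : Equiv.Perm (Fin n), |((Equiv.Perm.sign σ : ℤ) : ℝ) * ∏ i, B (σ i) i| := Finset.abs_sum_le_sum_abs _ _
    _ ≤ ∑ σ : Equiv.Perm (Fin n), a * b ^ (n - 1) := by
        gcongr with σ
        rw [abs_mul, Finset.abs_prod]
        have hs : |((Equiv.Perm.sign σ : ℤ) : ℝ)| = 1 := by
          rcases Int.units_eq_one_or (Equiv.Perm.sign σ) with h | h <;> simp [h]
        rw [hs, one_mul, ← hprod, ← Equiv.prod_comp σ c]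
        exact Finset.prod_le_prod (fun i _ => abs_nonneg _) (fun i _ => hBc _ _)
    _ = _ := by
        rw [Finset.sum_const, Finset.card_univ, Fintype.card_perm, Fintype.card_fin, nsmul_eq_mul]

/-- Determinant of `A` with row `i0` replaced by the functional `ψ`. -/
def rowDet {n : ℕ} (i0 : Fin n) (A : EuclideanSpace ℝ (Fin n) →L[ℝ] EuclideanSpace ℝ (Fin n))
    (ψ : EuclideanSpace ℝ (Fin n) →L[ℝ] ℝ) : ℝ :=
  ((mat A).updateRow i0 (fun j => ψ (EuclideanSpace.single j 1))).det

lemma mat_entry_le {n : ℕ} (A : EuclideanSpace ℝ (Fin n) →L[ℝ] EuclideanSpace ℝ (Fin n)) (i j : Fin n) :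
    |mat A i j| ≤ ‖A‖ := by
  have h1 : |A (EuclideanSpace.single j 1) i| ≤ ‖A (EuclideanSpace.single j 1)‖ :=
    PiLp.norm_apply_le (A (EuclideanSpace.single j 1)) i
  have h2 := A.le_opNorm (EuclideanSpace.single j 1)
  simp at h2
  exact h1.trans h2

lemma rowDet_bound {n : ℕ} (i0 : Fin n) (A : EuclideanSpace ℝ (Fin n) →L[ℝ] EuclideanSpace ℝ (Fin n))
    (ψ : EuclideanSpace ℝ (Fin n) →L[ℝ] ℝ) :
    |rowDet i0 A ψ| ≤ n.factorial * (‖ψ‖ * ‖A‖ ^ (n - 1)) := by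
  apply det_row_bound _ i0
  · intro j
    rw [Matrix.updateRow_self]
    have h2 := ψ.le_opNorm (EuclideanSpace.single j 1)
    simpa using h2
  · intro i hi j
    rw [Matrix.updateRow_ne hi]
    exact mat_entry_le A i j

lemma det_bound {n : ℕ} (hn : 1 ≤ n) (A : EuclideanSpace ℝ (Fin n) →L[ℝ] EuclideanSpace ℝ (Fin n)) :
    |A.det| ≤ n.factorial * ‖A‖ ^ n := by
  rw [← mat_det]
  have := det_row_bound (mat A) ⟨0, hn⟩ (a := ‖A‖) (b := ‖A‖) (fun j => mat_entry_le A _ j)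
    (fun i _ j => mat_entry_le A i j)
  rwa [← pow_succ', Nat.sub_add_cancel hn] at this

lemma rowDet_add_smul {n : ℕ} (i0 : Fin n) (A : EuclideanSpace ℝ (Fin n) →L[ℝ] EuclideanSpace ℝ (Fin n))
    (ψ θ : EuclideanSpace ℝ (Fin n) →L[ℝ] ℝ) (a b : ℝ) :
    rowDet i0 A (a • ψ + b • θ) = a * rowDet i0 A ψ + b * rowDet i0 A θ := by
  unfold rowDet
  rw [← Matrix.det_updateRow_smul, ← Matrix.det_updateRow_smul, ← Matrix.det_updateRow_add]
  rfl

lemma rowDet_proj {n : ℕ} (i0 : Fin n) (A : EuclideanSpace ℝ (Fin n) →L[ℝ] EuclideanSpace ℝ (Fin n)) :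
    rowDet i0 A ((EuclideanSpace.proj i0 : EuclideanSpace ℝ (Fin n) →L[ℝ] ℝ).comp A) = A.det := by
  unfold rowDet
  rw [← mat_det]
  congr 1
  exact Matrix.updateRow_eq_self _ _

lemma det_replace {n : ℕ} (i0 : Fin n) (A : EuclideanSpace ℝ (Fin n) →L[ℝ] EuclideanSpace ℝ (Fin n))
    (ψ : EuclideanSpace ℝ (Fin n) →L[ℝ] ℝ) :
    (A + (ψ - (EuclideanSpace.proj i0 : EuclideanSpace ℝ (Fin n) →L[ℝ] ℝ).comp A).smulRight
      (EuclideanSpace.single i0 (1:ℝ))).det = rowDet i0 A ψ := by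
  rw [← mat_det]
  unfold rowDet
  congr 1
  ext i j
  by_cases h : i = i0
  · subst h
    simp [mat]
  · rw [Matrix.updateRow_ne h]
    simp [mat, h]

lemma integrable_det {n : ℕ} (hn : 1 ≤ n)
    {g : EuclideanSpace ℝ (Fin n) → EuclideanSpace ℝ (Fin n)}
    {K : ℝ≥0} (hg : LipschitzWith K g) (hsupp : HasCompactSupport g) :
    Integrable (fun x => (fderiv ℝ g x).det) := by
  have hm : Measurable fun x => (fderiv ℝ g x).det :=
    ContinuousLinearMap.continuous_det.measurable.comp (measurable_fderiv ℝ g)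
  have : Integrable ((tsupport g).indicator (fun _ => (n.factorial * (K:ℝ) ^ n : ℝ))) :=
    (integrable_indicator_iff (isClosed_tsupport g).measurableSet).2
      (integrableOn_const hsupp.isCompact.measure_lt_top.ne)
  refine this.mono' hm.aestronglyMeasurable (Eventually.of_forall fun x => ?_)
  by_cases hx : x ∈ tsupport g
  · rw [Set.indicator_of_mem hx, Real.norm_eq_abs]
    refine (det_bound hn _).trans ?_
    gcongr
    exact norm_fderiv_le_of_lipschitz ℝ hg
  · rw [Set.indicator_of_notMem hx, fderiv_of_notMem_tsupport ℝ hx]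
    have := det_bound hn (0 : EuclideanSpace ℝ (Fin n) →L[ℝ] EuclideanSpace ℝ (Fin n))
    rw [norm_zero, zero_pow (by omega), mul_zero] at this
    exact this

/-- Replace the component `i0` of `U` by `w`. -/
def repl {n : ℕ} (i0 : Fin n) (U : EuclideanSpace ℝ (Fin n) → EuclideanSpace ℝ (Fin n))
    (w : EuclideanSpace ℝ (Fin n) → ℝ) (x : EuclideanSpace ℝ (Fin n)) : EuclideanSpace ℝ (Fin n) :=
  U x + (w x - U x i0) • EuclideanSpace.single i0 (1:ℝ)

lemma repl_fderiv {n : ℕ} (i0 : Fin n) {U : EuclideanSpace ℝ (Fin n) → EuclideanSpace ℝ (Fin n)}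
    {w : EuclideanSpace ℝ (Fin n) → ℝ} {x : EuclideanSpace ℝ (Fin n)}
    (hU : DifferentiableAt ℝ U x) (hw : DifferentiableAt ℝ w x) :
    HasFDerivAt (repl i0 U w) (fderiv ℝ U x + (fderiv ℝ w x -
      (EuclideanSpace.proj i0 : EuclideanSpace ℝ (Fin n) →L[ℝ] ℝ).comp (fderiv ℝ U x)).smulRight
      (EuclideanSpace.single i0 (1:ℝ))) x := by
  have h1 : HasFDerivAt (fun y => U y i0)
      ((EuclideanSpace.proj i0 : EuclideanSpace ℝ (Fin n) →L[ℝ] ℝ).comp (fderiv ℝ U x)) x :=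
    (EuclideanSpace.proj i0 : EuclideanSpace ℝ (Fin n) →L[ℝ] ℝ).hasFDerivAt.comp x hU.hasFDerivAt
  exact hU.hasFDerivAt.add ((hw.hasFDerivAt.sub h1).smul_const _)

lemma repl_det {n : ℕ} (i0 : Fin n) {U : EuclideanSpace ℝ (Fin n) → EuclideanSpace ℝ (Fin n)}
    {w : EuclideanSpace ℝ (Fin n) → ℝ} {x : EuclideanSpace ℝ (Fin n)}
    (hU : DifferentiableAt ℝ U x) (hw : DifferentiableAt ℝ w x) :
    (fderiv ℝ (repl i0 U w) x).det = rowDet i0 (fderiv ℝ U x) (fderiv ℝ w x) := by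
  rw [(repl_fderiv i0 hU hw).fderiv, det_replace]

lemma repl_lipschitz {n : ℕ} (i0 : Fin n) {U : EuclideanSpace ℝ (Fin n) → EuclideanSpace ℝ (Fin n)}
    {w : EuclideanSpace ℝ (Fin n) → ℝ} {K K' : ℝ≥0} (hU : LipschitzWith K U) (hw : LipschitzWith K' w) :
    ∃ K'', LipschitzWith K'' (repl i0 U w) := by
  have h1 : LipschitzWith _ (fun y => U y i0) :=
    (EuclideanSpace.proj i0 : EuclideanSpace ℝ (Fin n) →L[ℝ] ℝ).lipschitz.comp hU
  have h2 := (ContinuousLinearMap.smulRight (ContinuousLinearMap.id ℝ ℝ)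
    (EuclideanSpace.single i0 (1:ℝ))).lipschitz.comp (hw.sub h1)
  exact ⟨_, hU.add h2⟩

lemma repl_support {n : ℕ} (i0 : Fin n) {U : EuclideanSpace ℝ (Fin n) → EuclideanSpace ℝ (Fin n)}
    {w : EuclideanSpace ℝ (Fin n) → ℝ} (hU : HasCompactSupport U) (hw : HasCompactSupport w) :
    HasCompactSupport (repl i0 U w) := by
  refine HasCompactSupport.intro (hU.isCompact.union hw.isCompact) ?_
  intro x hx
  have h1 : U x = 0 := image_eq_zero_of_notMem_tsupport fun h => hx (Or.inl h)
  have h2 : w x = 0 := image_eq_zero_of_notMem_tsupport fun h => hx (Or.inr h)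
  simp [repl, h1, h2]


/-- The controlling function for the truncation argument. -/
def hfun {n : ℕ} (L : ℝ) (U : EuclideanSpace ℝ (Fin n) → EuclideanSpace ℝ (Fin n))
    (x : EuclideanSpace ℝ (Fin n)) : ℝ :=
  ‖fderiv ℝ U x‖ + (1 + L) * ‖U x‖

lemma hfun_continuous {n : ℕ} (L : ℝ) {U : EuclideanSpace ℝ (Fin n) → EuclideanSpace ℝ (Fin n)}
    (hU : ContDiff ℝ 1 U) : Continuous (hfun L U) :=
  (hU.continuous_fderiv one_ne_zero).norm.add (continuous_const.mul hU.continuous.norm)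

lemma hfun_zero {n : ℕ} (L : ℝ) {U : EuclideanSpace ℝ (Fin n) → EuclideanSpace ℝ (Fin n)}
    {x : EuclideanSpace ℝ (Fin n)} (hx : x ∉ tsupport U) : hfun L U x = 0 := by
  simp [hfun, fderiv_of_notMem_tsupport ℝ hx, image_eq_zero_of_notMem_tsupport hx]

lemma hfun_nonneg {n : ℕ} {L : ℝ} (hL : 0 ≤ L) (U : EuclideanSpace ℝ (Fin n) → EuclideanSpace ℝ (Fin n))
    (x : EuclideanSpace ℝ (Fin n)) : 0 ≤ hfun L U x := by
  unfold hfun; positivity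

lemma hfun_bdd {n : ℕ} (L : ℝ) {U : EuclideanSpace ℝ (Fin n) → EuclideanSpace ℝ (Fin n)}
    (hU : ContDiff ℝ 1 U) (hUs : HasCompactSupport U) : ∃ S, ∀ x, hfun L U x ≤ S := by
  have : HasCompactSupport (hfun L U) := HasCompactSupport.intro hUs.isCompact fun x hx => hfun_zero L hx
  obtain ⟨S, hS⟩ := this.exists_bound_of_continuous (hfun_continuous L hU)
  exact ⟨S, fun x => (le_abs_self _).trans (hS x)⟩

lemma vMax_zero {n : ℕ} {h : EuclideanSpace ℝ (Fin n) → ℝ} {x : EuclideanSpace ℝ (Fin n)}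
    (hx : ∀ y ∈ closedBall x 1, h y = 0) : vMax h x = 0 := by
  have h1 : hlMax (fun y => ENNReal.ofReal (h y)) x = 0 := by
    unfold hlMax
    rw [ENNReal.iSup_eq_zero]
    intro k
    have : ∫⁻ y in closedBall x ((1/2:ℝ)^k), ENNReal.ofReal (h y) = 0 := by
      rw [setLIntegral_congr_fun (g := fun _ => 0) measurableSet_closedBall]
      · simp
      · intro y hy
        have : h y = 0 := hx y (closedBall_subset_closedBall (pow_le_one₀ (by norm_num) (by norm_num)) hy)
        simp [this]
    rw [this, ENNReal.zero_div]
  unfold vMax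
  rw [h1, hx x (by simp)]
  simp

lemma trunc_ineq {n : ℕ} (hn : 1 ≤ n) (i0 : Fin n)
    {U : EuclideanSpace ℝ (Fin n) → EuclideanSpace ℝ (Fin n)}
    (hU : ContDiff ℝ 1 U) (hUs : HasCompactSupport U)
    {φ : EuclideanSpace ℝ (Fin n) → ℝ} (hφ : ContDiff ℝ 1 φ)
    (hφ0 : ∀ x, 0 ≤ φ x) (hφ1 : ∀ x, φ x ≤ 1) {L : ℝ} (hL : 0 ≤ L)
    (hφL : ∀ x, ‖fderiv ℝ φ x‖ ≤ L) (hdet : ∀ x, 0 ≤ φ x * (fderiv ℝ U x).det)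
    {l : ℝ} (hl : 0 < l) :
    ∫⁻ x in {x | l < vMax (hfun L U) x}, ENNReal.ofReal (φ x * (fderiv ℝ U x).det) ≤
    ∫⁻ x in {x | l < vMax (hfun L U) x}, ENNReal.ofReal (n.factorial * (2 * 4 ^ n + L) *
      (l * hfun L U x ^ (n - 1) + ‖U x‖ * hfun L U x ^ (n - 1))) := by
  obtain ⟨S, hS⟩ := hfun_bdd L hU hUs
  have hmh : Measurable (hfun L U) := (hfun_continuous L hU).measurable
  set h := hfun L U with hh
  have hh0 : ∀ x, 0 ≤ h x := hfun_nonneg hL U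
  have hmV : Measurable (vMax h) := measurable_vMax hmh
  set F : Set (EuclideanSpace ℝ (Fin n)) := {x | vMax h x ≤ l} with hF
  have hFm : MeasurableSet F := measurableSet_le hmV measurable_const
  have hFc : {x | l < vMax h x} = Fᶜ := by ext x; simp [hF]
  rw [hFc]
  set P : EuclideanSpace ℝ (Fin n) →L[ℝ] ℝ := EuclideanSpace.proj i0 with hP
  -- the function v
  set v : EuclideanSpace ℝ (Fin n) → ℝ := fun x => φ x * U x i0 with hv
  have hUi : ContDiff ℝ 1 (fun x => U x i0) := P.contDiff.comp hU
  have hvC : ContDiff ℝ 1 v := hφ.mul hUi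
  have hvs : HasCompactSupport v := by
    refine HasCompactSupport.intro hUs.isCompact fun x hx => ?_
    simp [hv, image_eq_zero_of_notMem_tsupport hx]
  have hUd : ∀ x, DifferentiableAt ℝ U x := fun x => hU.differentiable one_ne_zero x
  have hφd : ∀ x, DifferentiableAt ℝ φ x := fun x => hφ.differentiable one_ne_zero x
  have hvd : ∀ x, DifferentiableAt ℝ v x := fun x => hvC.differentiable one_ne_zero x
  have hv' : ∀ x, fderiv ℝ v x = φ x • P.comp (fderiv ℝ U x) + U x i0 • fderiv ℝ φ x := by
    intro x
    have h1 : HasFDerivAt (fun y => U y i0) (P.comp (fderiv ℝ U x)) x :=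
      P.hasFDerivAt.comp x (hUd x).hasFDerivAt
    exact ((hφd x).hasFDerivAt.mul h1).fderiv
  have hUi0 : ∀ x, |U x i0| ≤ ‖U x‖ := fun x => PiLp.norm_apply_le (U x) i0
  have hPn : ∀ A : EuclideanSpace ℝ (Fin n) →L[ℝ] EuclideanSpace ℝ (Fin n), ‖P.comp A‖ ≤ ‖A‖ := by
    intro A
    refine ContinuousLinearMap.opNorm_le_bound _ (norm_nonneg _) fun y => ?_
    exact (PiLp.norm_apply_le (A y) i0).trans (A.le_opNorm y)
  have hvh : ∀ x, ‖fderiv ℝ v x‖ ≤ h x := by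
    intro x
    rw [hv']
    refine (norm_add_le _ _).trans ?_
    rw [norm_smul, norm_smul, Real.norm_eq_abs, Real.norm_eq_abs, abs_of_nonneg (hφ0 x)]
    have e1 : φ x * ‖P.comp (fderiv ℝ U x)‖ ≤ 1 * ‖fderiv ℝ U x‖ := by
      gcongr
      · exact hφ1 x
      · exact hPn _
    have e2 : |U x i0| * ‖fderiv ℝ φ x‖ ≤ ‖U x‖ * L := by
      gcongr
      · exact hUi0 x
      · exact hφL x
    have := norm_nonneg (U x)
    simp only [hh, hfun]
    linarith
  have hvh0 : ∀ x, |v x| ≤ h x := by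
    intro x
    simp only [hv, abs_mul, abs_of_nonneg (hφ0 x)]
    have e1 : φ x * |U x i0| ≤ 1 * ‖U x‖ := by
      gcongr
      · exact hφ1 x
      · exact hUi0 x
    have := norm_nonneg (fderiv ℝ U x)
    have : 0 ≤ L * ‖U x‖ := by positivity
    simp only [hh, hfun]
    linarith
  -- truncation
  have hlip : LipschitzOnWith (Real.toNNReal (2 * 4 ^ n * l)) v F := by
    refine LipschitzOnWith.of_dist_le_mul fun x hx y hy => ?_
    rw [Real.coe_toNNReal _ (by positivity), Real.dist_eq]
    exact lip_est hS hmh hvC hvh hvh0 hl.le hx hy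
  obtain ⟨w, hwL, hwv⟩ := hlip.extend_real
  have hws : HasCompactSupport w := by
    refine HasCompactSupport.intro (hUs.isCompact.cthickening (r := 1)) fun x hx => ?_
    have hball : ∀ y ∈ closedBall x 1, h y = 0 := by
      intro y hy
      apply hfun_zero
      intro hyU
      exact hx (mem_cthickening_of_dist_le x y 1 _ hyU (by rw [dist_comm]; exact hy))
    have hxF : x ∈ F := by
      simp only [hF, Set.mem_ofPred_eq, vMax_zero hball]; exact hl.le
    rw [← hwv hxF]
    have := hvh0 x
    rw [hball x (by simp)] at this
    exact abs_nonpos_iff.1 this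
  obtain ⟨KU, hKU⟩ := hU.lipschitzWith_of_hasCompactSupport hUs one_ne_zero
  obtain ⟨Kv, hKv⟩ := hvC.lipschitzWith_of_hasCompactSupport hvs one_ne_zero
  obtain ⟨K1, hK1⟩ := repl_lipschitz i0 hKU hKv
  obtain ⟨K2, hK2⟩ := repl_lipschitz i0 hKU hwL
  have hs1 := repl_support i0 hUs hvs
  have hs2 := repl_support i0 hUs hws
  have I1 := integral_det_eq_zero hn hK1 hs1
  have I2 := integral_det_eq_zero hn hK2 hs2
  have J1 := integrable_det hn hK1 hs1
  have J2 := integrable_det hn hK2 hs2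
  have JU := integrable_det hn hKU hUs
  have hd2 : ∀ᵐ x, DifferentiableAt ℝ (repl i0 U w) x := hK2.ae_differentiableAt
  have hdw : ∀ᵐ x, DifferentiableAt ℝ w x := hwL.ae_differentiableAt
  have hd1 : ∀ x, DifferentiableAt ℝ (repl i0 U v) x := fun x =>
    (repl_fderiv i0 (hUd x) (hvd x)).differentiableAt
  have hz : ∀ᵐ x ∂(volume.restrict F), fderiv ℝ (fun y => repl i0 U v y - repl i0 U w y) x = 0 := by
    refine fderiv_zero_ae (hK1.sub hK2) hFm fun x hx => ?_
    simp [repl, hwv hx]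
  have hF12 : ∫ x in F, (fderiv ℝ (repl i0 U v) x).det = ∫ x in F, (fderiv ℝ (repl i0 U w) x).det := by
    refine integral_congr_ae ?_
    filter_upwards [hz, ae_restrict_of_ae hd2] with x h1 h2
    rw [fderiv_fun_sub (hd1 x) h2] at h1
    rw [sub_eq_zero.1 h1]
  have hFc12 : ∫ x in Fᶜ, (fderiv ℝ (repl i0 U v) x).det = ∫ x in Fᶜ, (fderiv ℝ (repl i0 U w) x).det := by
    have a1 := integral_add_compl hFm J1
    have a2 := integral_add_compl hFm J2
    rw [I1] at a1; rw [I2] at a2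
    linarith
  have hdet1 : ∀ x, (fderiv ℝ (repl i0 U v) x).det =
      φ x * (fderiv ℝ U x).det + U x i0 * rowDet i0 (fderiv ℝ U x) (fderiv ℝ φ x) := by
    intro x
    rw [repl_det i0 (hUd x) (hvd x), hv', rowDet_add_smul, rowDet_proj]
  have JφU : Integrable (fun x => φ x * (fderiv ℝ U x).det) := by
    refine JU.mono (hφ.continuous.aestronglyMeasurable.mul JU.1) (Eventually.of_forall fun x => ?_)
    rw [norm_mul, Real.norm_eq_abs, abs_of_nonneg (hφ0 x)]
    exact mul_le_of_le_one_left (norm_nonneg _) (hφ1 x)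
  have key : ∫ x in Fᶜ, φ x * (fderiv ℝ U x).det = ∫ x in Fᶜ, ((fderiv ℝ (repl i0 U w) x).det -
      U x i0 * rowDet i0 (fderiv ℝ U x) (fderiv ℝ φ x)) := by
    have e : (fun x => U x i0 * rowDet i0 (fderiv ℝ U x) (fderiv ℝ φ x)) =
        fun x => (fderiv ℝ (repl i0 U v) x).det - φ x * (fderiv ℝ U x).det := by
      ext x; rw [hdet1]; ring
    rw [integral_sub J2.integrableOn, ← hFc12]
    · rw [e, integral_sub J1.integrableOn JφU.integrableOn]; ring
    · rw [e]; exact (J1.sub JφU).integrableOn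
  rw [← ofReal_integral_eq_lintegral_ofReal JφU.integrableOn (Eventually.of_forall hdet), key]
  refine (ENNReal.ofReal_le_ofReal (le_abs_self _)).trans ?_
  rw [← Real.norm_eq_abs, ofReal_norm]
  refine (enorm_integral_le_lintegral_enorm _).trans ?_
  refine lintegral_mono_ae ?_
  filter_upwards [ae_restrict_of_ae hdw] with x hx
  rw [← ofReal_norm]
  refine ENNReal.ofReal_le_ofReal ?_
  rw [repl_det i0 (hUd x) hx, Real.norm_eq_abs]
  refine (abs_sub _ _).trans ?_
  have hUh : ‖fderiv ℝ U x‖ ≤ h x := by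
    simp only [hh, hfun]
    have : 0 ≤ (1 + L) * ‖U x‖ := by positivity
    linarith
  have e1 : |rowDet i0 (fderiv ℝ U x) (fderiv ℝ w x)| ≤ n.factorial * ((2 * 4 ^ n * l) * h x ^ (n - 1)) := by
    refine (rowDet_bound _ _ _).trans ?_
    gcongr
    have := norm_fderiv_le_of_lipschitz ℝ hwL (x₀ := x)
    rwa [Real.coe_toNNReal _ (by positivity)] at this
  have e2 : |U x i0 * rowDet i0 (fderiv ℝ U x) (fderiv ℝ φ x)| ≤ ‖U x‖ * (n.factorial * (L * h x ^ (n - 1))) := by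
    rw [abs_mul]
    gcongr
    · exact hUi0 x
    · refine (rowDet_bound _ _ _).trans ?_
      gcongr
      exact hφL x
  have p1 : 0 ≤ (n.factorial : ℝ) * L * (l * h x ^ (n - 1)) := by
    have := hh0 x; positivity
  have p2 : 0 ≤ (n.factorial : ℝ) * (2 * 4 ^ n) * (‖U x‖ * h x ^ (n - 1)) := by
    have := hh0 x; positivity
  nlinarith


lemma layer_swap {α : Type*} [MeasurableSpace α] {μ : Measure α} [SFinite μ]
    {V : α → ℝ} (hV : Measurable V) {f : α → ℝ≥0∞} (hf : Measurable f)
    {c : ℝ → ℝ≥0∞} (hc : Measurable c) :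
    ∫⁻ l in Set.Ioi (1:ℝ), c l * ∫⁻ x in {x | l < V x}, f x ∂μ =
      ∫⁻ x, f x * (∫⁻ l in Set.Ioo 1 (V x), c l) ∂μ := by
  have hset : MeasurableSet {p : ℝ × α | p.1 < V p.2} :=
    measurableSet_lt measurable_fst (hV.comp measurable_snd)
  have e1 : ∀ l, c l * ∫⁻ x in {x | l < V x}, f x ∂μ =
      ∫⁻ x, ({p : ℝ × α | p.1 < V p.2}).indicator (fun p => c p.1 * f p.2) (l, x) ∂μ := by
    intro l
    rw [← lintegral_const_mul _ hf, ← lintegral_indicator (measurableSet_lt measurable_const hV)]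
    rfl
  simp_rw [e1]
  rw [lintegral_lintegral_swap]
  · refine lintegral_congr fun x => ?_
    have : Set.Ioo 1 (V x) = Set.Iio (V x) ∩ Set.Ioi 1 := by ext; simp [and_comm]
    rw [this, ← Measure.restrict_restrict measurableSet_Iio, ← lintegral_const_mul _ hc,
      ← lintegral_indicator measurableSet_Iio]
    refine lintegral_congr fun l => ?_
    by_cases h : l < V x
    · rw [Set.indicator_of_mem (by exact h), Set.indicator_of_mem (by exact h), mul_comm]
    · rw [Set.indicator_of_notMem (by exact h), Set.indicator_of_notMem (by exact h)]
  · exact (((hc.comp measurable_fst).mul (hf.comp measurable_snd)).indicator hset).aemeasurable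

lemma lint_inv {V : ℝ} (hV0 : 0 ≤ V) :
    ∫⁻ l in Set.Ioo 1 V, ENNReal.ofReal (1 / l) = ENNReal.ofReal (Real.posLog V) := by
  by_cases h : 1 < V
  · rw [← ofReal_integral_eq_lintegral_ofReal, ← integral_Ioc_eq_integral_Ioo,
      ← intervalIntegral.integral_of_le h.le, integral_one_div_of_pos one_pos (by linarith), div_one,
      Real.posLog_eq_log (by rw [abs_of_pos (by linarith)]; exact h.le)]
    · have : IntegrableOn (fun l : ℝ => 1 / l) (Set.Icc 1 V) := by
        refine ContinuousOn.integrableOn_Icc ?_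
        refine continuousOn_const.div continuousOn_id fun x hx => ?_
        have := hx.1
        simp; linarith
      exact this.mono_set Set.Ioo_subset_Icc_self
    · refine (ae_restrict_iff' measurableSet_Ioo).2 (Eventually.of_forall fun l hl => ?_)
      have := hl.1
      simp; linarith
  · rw [Set.Ioo_eq_empty h]
    rw [(Real.posLog_eq_zero_iff V).2 (by rw [abs_of_nonneg hV0]; exact not_lt.1 h)]
    simp

lemma layer_ineq {α : Type*} [MeasurableSpace α] {μ : Measure α} [SFinite μ]
    {V : α → ℝ} (hV : Measurable V) (hV0 : ∀ x, 0 ≤ V x) {f g1 g2 : α → ℝ≥0∞} (hf : Measurable f)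
    (hg1 : Measurable g1) (hg2 : Measurable g2)
    (H : ∀ l : ℝ, 0 < l → ∫⁻ x in {x | l < V x}, f x ∂μ ≤
      ENNReal.ofReal l * ∫⁻ x in {x | l < V x}, g1 x ∂μ + ∫⁻ x in {x | l < V x}, g2 x ∂μ) :
    ∫⁻ x, f x * ENNReal.ofReal (Real.posLog (V x)) ∂μ ≤
      ∫⁻ x, g1 x * ENNReal.ofReal (V x) ∂μ + ∫⁻ x, g2 x * ENNReal.ofReal (Real.posLog (V x)) ∂μ := by
  have hc : Measurable fun l : ℝ => ENNReal.ofReal (1 / l) := by fun_prop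
  simp_rw [fun x => (lint_inv (hV0 x)).symm]
  rw [← layer_swap hV hf hc, ← layer_swap hV hg2 hc]
  have h1 : ∫⁻ l in Set.Ioi (1:ℝ), 1 * ∫⁻ x in {x | l < V x}, g1 x ∂μ ≤
      ∫⁻ x, g1 x * ENNReal.ofReal (V x) ∂μ := by
    rw [layer_swap hV hg1 measurable_const]
    gcongr with x
    simp
    exact ENNReal.ofReal_le_ofReal (by linarith)
  refine le_trans ?_ (add_le_add_left h1 _)
  have hanti : Antitone fun l : ℝ => ∫⁻ x in {x | l < V x}, g1 x ∂μ := by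
    intro a b hab
    exact lintegral_mono_set fun x hx => lt_of_le_of_lt hab hx
  rw [← lintegral_add_left (hanti.measurable.const_mul 1)]
  refine setLIntegral_mono' measurableSet_Ioi fun l hl => ?_
  have hl0 : (0:ℝ) < l := lt_trans one_pos hl
  refine (mul_le_mul_right (H l hl0) _).trans (le_of_eq ?_)
  rw [mul_add, ← mul_assoc, ← ENNReal.ofReal_mul (by positivity), one_div_mul_cancel hl0.ne', ENNReal.ofReal_one]

lemma young_log {a V : ℝ} (n : ℕ) (hn : 1 ≤ n) (ha : 0 ≤ a) (hV : 0 ≤ V) :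
    a * V ^ (n - 1) * Real.posLog V ≤ 2 * (V ^ n + a ^ (2 * n)) := by
  have hs := Real.sqrt_nonneg V
  set s := Real.sqrt V with hsd
  have hVs : V = s ^ 2 := (Real.sq_sqrt hV).symm
  have h1 : Real.posLog V ≤ 2 * s := by
    rw [hVs, Real.posLog_pow, Nat.cast_ofNat]
    refine mul_le_mul_of_nonneg_left ?_ (by norm_num)
    rw [Real.posLog_apply]
    exact max_le hs (Real.log_le_self hs)
  obtain ⟨m, rfl⟩ : ∃ m, n = m + 1 := ⟨n - 1, by omega⟩
  rw [Nat.add_sub_cancel]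
  have h2 : a * V ^ m * Real.posLog V ≤ a * V ^ m * (2 * s) := by gcongr
  refine h2.trans ?_
  rcases le_total a s with h | h
  · have : a * V ^ m * (2 * s) ≤ s * V ^ m * (2 * s) := by gcongr
    have h3 : s * V ^ m * (2 * s) = 2 * V ^ (m + 1) := by rw [pow_succ, hVs]; ring
    have : 0 ≤ a ^ (2 * (m + 1)) := by positivity
    linarith
  · have hVa : V ≤ a ^ 2 := by rw [hVs]; gcongr
    have : a * V ^ m * (2 * s) ≤ a * (a ^ 2) ^ m * (2 * a) := by gcongr
    have h3 : a * (a ^ 2) ^ m * (2 * a) = 2 * a ^ (2 * (m + 1)) := by ring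
    have : 0 ≤ V ^ (m + 1) := by positivity
    linarith

lemma log_ineq {n : ℕ} (hn : 1 ≤ n)
    {U : EuclideanSpace ℝ (Fin n) → EuclideanSpace ℝ (Fin n)}
    (hU : ContDiff ℝ 1 U) (hUs : HasCompactSupport U)
    {φ : EuclideanSpace ℝ (Fin n) → ℝ} (hφ : ContDiff ℝ 1 φ)
    (hφ0 : ∀ x, 0 ≤ φ x) (hφ1 : ∀ x, φ x ≤ 1) {L : ℝ} (hL : 0 ≤ L)
    (hφL : ∀ x, ‖fderiv ℝ φ x‖ ≤ L) (hdet : ∀ x, 0 ≤ φ x * (fderiv ℝ U x).det) :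
    ∫⁻ x, ENNReal.ofReal (φ x * (fderiv ℝ U x).det) * ENNReal.ofReal (Real.posLog (vMax (hfun L U) x)) ≤
    ENNReal.ofReal (3 * (n.factorial * (2 * 4 ^ n + L))) *
      ((∫⁻ x, ENNReal.ofReal (vMax (hfun L U) x ^ n)) + ∫⁻ x, ENNReal.ofReal (‖U x‖ ^ (2 * n))) := by
  have hmh : Measurable (hfun L U) := (hfun_continuous L hU).measurable
  have hT := fun l hl => trunc_ineq hn ⟨0, hn⟩ hU hUs hφ hφ0 hφ1 hL hφL hdet (l := l) hl
  set h := hfun L U with hh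
  have hh0 : ∀ x, 0 ≤ h x := hfun_nonneg hL U
  have hmV : Measurable (vMax h) := measurable_vMax hmh
  have hV0 : ∀ x, 0 ≤ vMax h x := fun x => (hh0 x).trans (le_vMax h x)
  set C : ℝ := n.factorial * (2 * 4 ^ n + L) with hC
  have hC0 : 0 ≤ C := by positivity
  have hmU : Measurable U := hU.continuous.measurable
  have mdet : Measurable fun x => (fderiv ℝ U x).det :=
    ContinuousLinearMap.continuous_det.measurable.comp (measurable_fderiv ℝ U)
  have hmf : Measurable fun x => ENNReal.ofReal (φ x * (fderiv ℝ U x).det) :=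
    (hφ.continuous.measurable.mul mdet).ennreal_ofReal
  have hm1 : Measurable fun x => ENNReal.ofReal (C * h x ^ (n - 1)) := by fun_prop
  have hm2 : Measurable fun x => ENNReal.ofReal (C * (‖U x‖ * h x ^ (n - 1))) := by fun_prop
  refine (layer_ineq hmV hV0 hmf hm1 hm2 fun l hl => ?_).trans ?_
  · refine (hT l hl).trans (le_of_eq ?_)
    rw [← lintegral_const_mul _ hm1, ← lintegral_add_left (hm1.const_mul _)]
    refine lintegral_congr fun x => ?_
    have := hh0 x
    rw [← ENNReal.ofReal_mul hl.le, ← ENNReal.ofReal_add (by positivity) (by positivity)]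
    congr 1; ring
  · have hmm : Measurable fun x => ENNReal.ofReal (vMax h x ^ n) := (hmV.pow_const n).ennreal_ofReal
    have hmm2 : Measurable fun x => ENNReal.ofReal (‖U x‖ ^ (2 * n)) := by fun_prop
    have hml : Measurable fun x => ENNReal.ofReal (vMax h x) := hmV.ennreal_ofReal
    have hms : Measurable fun x => ENNReal.ofReal (vMax h x ^ n) + ENNReal.ofReal (‖U x‖ ^ (2 * n)) :=
      hmm.add hmm2
    have hmp : Measurable fun x => ENNReal.ofReal (C * h x ^ (n - 1)) * ENNReal.ofReal (vMax h x) :=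
      hm1.mul hml
    rw [← lintegral_add_left hmm, ← lintegral_const_mul _ hms,
      ← lintegral_add_left hmp]
    refine lintegral_mono fun x => ?_
    have a0 := hh0 x
    have a1 := hV0 x
    have a2 := norm_nonneg (U x)
    have a3 : 0 ≤ Real.posLog (vMax h x) := Real.posLog_nonneg
    have a4 : h x ^ (n - 1) ≤ vMax h x ^ (n - 1) := by
      gcongr
      exact le_vMax h x
    simp only []
    rw [← ENNReal.ofReal_mul (by positivity), ← ENNReal.ofReal_mul (by positivity),
      ← ENNReal.ofReal_add (by positivity) (by positivity),
      ← ENNReal.ofReal_add (by positivity) (by positivity), ← ENNReal.ofReal_mul (by positivity)]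
    refine ENNReal.ofReal_le_ofReal ?_
    have b1 : h x ^ (n - 1) * vMax h x ≤ vMax h x ^ n := by
      calc _ ≤ vMax h x ^ (n - 1) * vMax h x := by gcongr
        _ = _ := by rw [← pow_succ, Nat.sub_add_cancel hn]
    have b2 : ‖U x‖ * h x ^ (n - 1) * Real.posLog (vMax h x) ≤ 2 * (vMax h x ^ n + ‖U x‖ ^ (2 * n)) := by
      refine le_trans ?_ (young_log n hn a2 a1)
      gcongr
    have b3 : 0 ≤ C * ‖U x‖ ^ (2 * n) := by positivity
    have b4 := mul_le_mul_of_nonneg_left b1 hC0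
    have b5 := mul_le_mul_of_nonneg_left b2 hC0
    linarith


lemma gns_bound {n : ℕ} (hn : 2 ≤ n) {s : Set (EuclideanSpace ℝ (Fin n))} (hs : Bornology.IsBounded s)
    (hsm : MeasurableSet s) :
    ∃ K : ℝ≥0, ∀ U : EuclideanSpace ℝ (Fin n) → EuclideanSpace ℝ (Fin n), ContDiff ℝ 1 U →
      tsupport U ⊆ s →
      ∫⁻ x, ENNReal.ofReal (‖U x‖ ^ (2 * n)) ≤
        K * (volume s + ∫⁻ x, ENNReal.ofReal (‖fderiv ℝ U x‖ ^ n)) ^ 3 := by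
  have hnr : (2:ℝ) ≤ n := by exact_mod_cast hn
  have hn0 : (0:ℝ) < n := by linarith
  set p : ℝ≥0 := 2 * n / 3 with hp
  set q : ℝ≥0 := ((2 * n : ℕ) : ℝ≥0) with hq
  have hpr : (p : ℝ) = 2 * n / 3 := by simp [hp]
  have hqr : (q : ℝ) = 2 * n := by simp [hq]
  have hp0 : p ≠ 0 := by
    have : (0:ℝ) < p := by rw [hpr]; positivity
    exact (NNReal.coe_pos.1 this).ne'
  have hq0 : q ≠ 0 := by
    rw [hq, Nat.cast_ne_zero]; omega
  set K0 : ℝ≥0 := eLpNormLESNormFDerivOfLeConst (EuclideanSpace ℝ (Fin n))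
    (volume : Measure (EuclideanSpace ℝ (Fin n))) s p q with hK0
  refine ⟨K0 ^ (2 * n), fun U hU hUs => ?_⟩
  have h1 : eLpNorm U q volume ≤ K0 * eLpNorm (fderiv ℝ U) p volume := by
    refine eLpNorm_le_eLpNorm_fderiv_of_le volume hU ((subset_tsupport U).trans hUs) ?_ ?_ ?_ hs
    · rw [← NNReal.coe_le_coe, hpr]; simp; linarith
    · rw [← NNReal.coe_lt_coe, hpr]; simp; linarith
    · rw [NNReal.coe_inv, hpr, hqr]
      simp only [finrank_euclideanSpace, Fintype.card_fin]
      apply le_of_eq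
      field_simp
      norm_num
  have h2 : eLpNorm U q volume ^ (q:ℝ) ≤ (K0 * eLpNorm (fderiv ℝ U) p volume) ^ (q:ℝ) := by
    gcongr
  have h3 : eLpNorm U q volume ^ (q:ℝ) = ∫⁻ x, ENNReal.ofReal (‖U x‖ ^ (2 * n)) := by
    rw [eLpNorm_nnreal_pow_eq_lintegral hq0]
    refine lintegral_congr fun x => ?_
    rw [ENNReal.ofReal_pow (norm_nonneg _), ofReal_norm, hq, NNReal.coe_natCast, ENNReal.rpow_natCast]
  have h4 : (K0 * eLpNorm (fderiv ℝ U) p volume) ^ (q:ℝ) =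
      (K0 ^ (2 * n) : ℝ≥0) * (∫⁻ x, ‖fderiv ℝ U x‖ₑ ^ (p:ℝ)) ^ 3 := by
    rw [ENNReal.mul_rpow_of_nonneg _ _ (NNReal.coe_nonneg q), ← eLpNorm_nnreal_pow_eq_lintegral hp0,
      ← ENNReal.rpow_natCast, ← ENNReal.rpow_mul]
    congr 1
    · rw [hq, NNReal.coe_natCast, ENNReal.rpow_natCast, ENNReal.coe_pow]
    · congr 1
      rw [hpr, hqr]; push_cast; ring
  rw [h3, h4] at h2
  refine h2.trans ?_
  gcongr
  rw [← lintegral_indicator_one hsm, ← lintegral_add_left (measurable_one.indicator hsm)]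
  refine lintegral_mono fun x => ?_
  by_cases hx : x ∈ s
  · simp only [Set.indicator_of_mem hx, Pi.one_apply]
    rw [ENNReal.ofReal_pow (norm_nonneg _), ofReal_norm, ← ENNReal.rpow_natCast]
    rcases le_total ‖fderiv ℝ U x‖ₑ 1 with h | h
    · exact (ENNReal.rpow_le_one h p.2).trans le_self_add
    · refine le_trans ?_ le_add_self
      refine ENNReal.rpow_le_rpow_of_exponent_le h ?_
      rw [hpr]; linarith
  · have hz : ‖fderiv ℝ U x‖ₑ = 0 := by
      rw [← ofReal_norm, fderiv_of_notMem_tsupport ℝ fun h => hx (hUs h), norm_zero, ENNReal.ofReal_zero]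
    rw [hz, ENNReal.zero_rpow_of_pos (by rw [hpr]; positivity)]
    exact zero_le


lemma opNorm_le_frob {n : ℕ} (A : EuclideanSpace ℝ (Fin n) →L[ℝ] EuclideanSpace ℝ (Fin n)) :
    ‖A‖ ≤ frob (mat A) := by
  refine ContinuousLinearMap.opNorm_le_bound _ (Real.sqrt_nonneg _) fun y => ?_
  have hAy : ∀ i, A y i = ∑ j, mat A i j * y j := by
    intro i
    have hy : y = ∑ j, y j • EuclideanSpace.single j (1:ℝ) := by
      ext k
      simp [Finset.sum_apply, Pi.single_apply]
    conv_lhs => rw [hy]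
    rw [map_sum]
    simp [mat, mul_comm]
  rw [EuclideanSpace.norm_eq, EuclideanSpace.norm_eq]
  unfold frob
  rw [← Real.sqrt_mul (by positivity)]
  refine Real.sqrt_le_sqrt ?_
  rw [Finset.sum_mul]
  refine Finset.sum_le_sum fun i _ => ?_
  simp only [Real.norm_eq_abs, sq_abs]
  rw [hAy]
  exact Finset.sum_mul_sq_le_sq_mul_sq _ _ _

lemma exists_cutoff {n : ℕ} {K Ω : Set (EuclideanSpace ℝ (Fin n))} (hK : IsCompact K)
    (hΩ : IsOpen Ω) (hKΩ : K ⊆ Ω) :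
    ∃ φ : EuclideanSpace ℝ (Fin n) → ℝ, ContDiff ℝ 1 φ ∧ HasCompactSupport φ ∧ tsupport φ ⊆ Ω ∧
      (∀ᶠ x in 𝓝ˢ K, φ x = 1) ∧ (∀ x, 0 ≤ φ x) ∧ (∀ x, φ x ≤ 1) ∧
      ∃ L : ℝ, 0 ≤ L ∧ ∀ x, ‖fderiv ℝ φ x‖ ≤ L := by
  obtain ⟨K', hK', h1, h2⟩ := exists_compact_between hK hΩ hKΩ
  obtain ⟨f, hf1, hf0, hf⟩ := exists_contMDiffMap_one_nhds_of_subset_interior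
    (modelWithCornersSelf ℝ (EuclideanSpace ℝ (Fin n))) hK.isClosed h1 (n := 1)
  have hsub : tsupport (f : EuclideanSpace ℝ (Fin n) → ℝ) ⊆ K' := by
    refine closure_minimal ?_ hK'.isClosed
    intro x hx
    by_contra h
    exact hx (hf0 x h)
  have hC : ContDiff ℝ 1 (f : EuclideanSpace ℝ (Fin n) → ℝ) := f.contMDiff.contDiff
  have hcs : HasCompactSupport (f : EuclideanSpace ℝ (Fin n) → ℝ) :=
    hK'.of_isClosed_subset (isClosed_tsupport _) hsub
  obtain ⟨L, hL⟩ := (hcs.fderiv ℝ).exists_bound_of_continuous (hC.continuous_fderiv one_ne_zero)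
  exact ⟨f, hC, hcs, hsub.trans h2, hf1, fun x => (hf x).1, fun x => (hf x).2, max L 0, le_max_right _ _,
    fun x => (hL x).trans (le_max_left _ _)⟩

lemma log_bound {n : ℕ} {f V : ℝ} (hf : 0 ≤ f) (hV : 0 ≤ V) (hfV : f ≤ n.factorial * V ^ n) :
    f * Real.log (2 + f) ≤ (Real.log (2 + n.factorial) * n.factorial) * V ^ n +
      n * (f * Real.posLog V) := by
  have h1 : Real.log (2 + f) ≤ Real.log (2 + n.factorial) + n * Real.posLog V := by
    rw [Real.posLog_eq_log_max_one hV, ← Real.log_pow, ← Real.log_mul (by positivity) (by positivity)]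
    refine Real.log_le_log (by linarith) ?_
    have h2 : 1 ≤ max 1 V ^ n := one_le_pow₀ (le_max_left _ _)
    have h3 : V ^ n ≤ max 1 V ^ n := by gcongr; exact le_max_right _ _
    have h4 : (n.factorial : ℝ) * V ^ n ≤ n.factorial * max 1 V ^ n := by gcongr
    linarith
  have hlog : 0 ≤ Real.log (2 + n.factorial) := by
    apply Real.log_nonneg
    have : (0:ℝ) ≤ n.factorial := by positivity
    linarith
  calc _ ≤ f * (Real.log (2 + n.factorial) + n * Real.posLog V) := by gcongr
    _ = Real.log (2 + n.factorial) * f + n * (f * Real.posLog V) := by ring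
    _ ≤ Real.log (2 + n.factorial) * (n.factorial * V ^ n) + n * (f * Real.posLog V) := by gcongr
    _ = _ := by ring

/-- Müller's higher integrability of nonnegative Jacobians: for `n ≥ 2`, a bounded open
`Ω ⊆ ℝⁿ`, a compact `ω ⊆ Ω` and `M > 0`, there is `C > 0` (depending only on `n, Ω, ω, M`)
such that every `C¹` map `u : Ω → ℝⁿ` with `∫_Ω (|u|ⁿ + |∇u|ⁿ) ≤ Mⁿ` and `det ∇u ≥ 0`
on `Ω` satisfies `∫_ω det ∇u · log(2 + det ∇u) ≤ C`. (The integrals of the nonnegative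
integrands are taken as lower Lebesgue integrals.) -/
theorem stmt13 {n : ℕ} (hn : 2 ≤ n)
    (Ω : Set (EuclideanSpace ℝ (Fin n))) (hΩo : IsOpen Ω) (hΩb : Bornology.IsBounded Ω)
    (ω : Set (EuclideanSpace ℝ (Fin n))) (hω : IsCompact ω) (hsub : ω ⊆ Ω)
    (M : ℝ) (hM : 0 < M) :
    ∃ C : ℝ, 0 < C ∧
      ∀ u : EuclideanSpace ℝ (Fin n) → EuclideanSpace ℝ (Fin n),
        ContDiffOn ℝ 1 u Ω →
        (∫⁻ x in Ω, ENNReal.ofReal (‖u x‖ ^ n + frob (grad u x) ^ n)) ≤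
          ENNReal.ofReal (M ^ n) →
        (∀ x ∈ Ω, 0 ≤ (grad u x).det) →
        (∫⁻ x in ω, ENNReal.ofReal ((grad u x).det * Real.log (2 + (grad u x).det))) ≤
          ENNReal.ofReal C := by
  have hn1 : 1 ≤ n := by omega
  obtain ⟨φ, hφ, hφc, hφΩ, hφω, hφ0, hφ1, L, hL, hφL⟩ := exists_cutoff hω hΩo hsub
  obtain ⟨χ, hχ, hχc, hχΩ, hχφ, hχ0, hχ1, L', hL', hχL⟩ := exists_cutoff hφc.isCompact hΩo hφΩ
  obtain ⟨K, hK⟩ := gns_bound hn hΩb hΩo.measurableSet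
  set B : ℝ := 1 + L + L' with hB
  have hB1 : 1 ≤ B := by linarith
  set D : ℝ≥0∞ := ENNReal.ofReal (B ^ n * 2 ^ (n - 1)) * ENNReal.ofReal (M ^ n) with hD
  set X : ℝ≥0∞ := ENNReal.ofReal (1 + n * 2 * 5 ^ n * 2 ^ (n - 1)) * D with hX
  set Y : ℝ≥0∞ := K * (volume Ω + D) ^ 3 with hY
  set T : ℝ≥0∞ := ENNReal.ofReal (Real.log (2 + n.factorial) * n.factorial) * X +
    ENNReal.ofReal n * (ENNReal.ofReal (3 * (n.factorial * (2 * 4 ^ n + L))) * (X + Y)) with hT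
  have hDt : D ≠ ⊤ := ENNReal.mul_ne_top ENNReal.ofReal_ne_top ENNReal.ofReal_ne_top
  have hXt : X ≠ ⊤ := ENNReal.mul_ne_top ENNReal.ofReal_ne_top hDt
  have hYt : Y ≠ ⊤ := ENNReal.mul_ne_top ENNReal.coe_ne_top
    (ENNReal.pow_ne_top (ENNReal.add_ne_top.2 ⟨hΩb.measure_lt_top.ne, hDt⟩))
  have hTt : T ≠ ⊤ := ENNReal.add_ne_top.2 ⟨ENNReal.mul_ne_top ENNReal.ofReal_ne_top hXt,
    ENNReal.mul_ne_top ENNReal.ofReal_ne_top (ENNReal.mul_ne_top ENNReal.ofReal_ne_top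
      (ENNReal.add_ne_top.2 ⟨hXt, hYt⟩))⟩
  refine ⟨T.toReal + 1, by positivity, fun u hu hIntBd hdetu => ?_⟩
  have hTle : T ≤ ENNReal.ofReal (T.toReal + 1) := by
    rw [← ENNReal.ofReal_toReal hTt]
    refine ENNReal.ofReal_le_ofReal ?_
    rw [ENNReal.ofReal_toReal hTt]; linarith
  refine le_trans ?_ hTle
  -- the localized map
  set U : EuclideanSpace ℝ (Fin n) → EuclideanSpace ℝ (Fin n) := fun x => χ x • u x with hUdef
  have hUsub : tsupport U ⊆ tsupport χ := tsupport_smul_subset_left χ u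
  have huat : ∀ x ∈ Ω, ContDiffAt ℝ 1 u x := fun x hx => hu.contDiffAt (hΩo.mem_nhds hx)
  have hU : ContDiff ℝ 1 U := by
    rw [contDiff_iff_contDiffAt]
    intro x
    by_cases hx : x ∈ Ω
    · exact hχ.contDiffAt.smul (huat x hx)
    · have hx' : x ∉ tsupport U := fun h => hx (hχΩ (hUsub h))
      have : U =ᶠ[𝓝 x] fun _ => 0 := notMem_tsupport_iff_eventuallyEq.1 hx'
      exact contDiffAt_const.congr_of_eventuallyEq this
  have hUs : HasCompactSupport U := hχc.isCompact.of_isClosed_subset (isClosed_tsupport _) hUsub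
  have hUu : ∀ x ∈ tsupport φ, fderiv ℝ U x = fderiv ℝ u x := by
    intro x hx
    refine Filter.EventuallyEq.fderiv_eq ?_
    filter_upwards [eventually_nhdsSet_iff_forall.1 hχφ x hx] with y hy
    simp [hUdef, hy]
  have hdet : ∀ x, 0 ≤ φ x * (fderiv ℝ U x).det := by
    intro x
    by_cases hx : x ∈ tsupport φ
    · refine mul_nonneg (hφ0 x) ?_
      rw [hUu x hx, ← grad_det]
      exact hdetu x (hφΩ hx)
    · rw [image_eq_zero_of_notMem_tsupport hx, zero_mul]
  set h := hfun L U with hh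
  have hh0 : ∀ x, 0 ≤ h x := hfun_nonneg hL U
  have hmh : Measurable h := (hfun_continuous L hU).measurable
  obtain ⟨S, hS⟩ := hfun_bdd L hU hUs
  have hmV : Measurable (vMax h) := measurable_vMax hmh
  have hV0 : ∀ x, 0 ≤ vMax h x := fun x => (hh0 x).trans (le_vMax h x)
  have hUh : ∀ x, ‖fderiv ℝ U x‖ ≤ h x := by
    intro x
    simp only [hh, hfun]
    have : 0 ≤ (1 + L) * ‖U x‖ := by positivity
    linarith
  have hhu : ∀ x ∈ Ω, h x ^ n ≤ B ^ n * 2 ^ (n - 1) * (‖u x‖ ^ n + frob (grad u x) ^ n) := by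
    intro x hx
    have hf : ‖fderiv ℝ u x‖ ≤ frob (grad u x) := opNorm_le_frob _
    have hf0 : 0 ≤ frob (grad u x) := Real.sqrt_nonneg _
    have hu0 := norm_nonneg (u x)
    have e1 : ‖U x‖ ≤ ‖u x‖ := by
      simp only [hUdef, norm_smul, Real.norm_eq_abs, abs_of_nonneg (hχ0 x)]
      exact mul_le_of_le_one_left hu0 (hχ1 x)
    have e2 : ‖fderiv ℝ U x‖ ≤ ‖fderiv ℝ u x‖ + L' * ‖u x‖ := by
      have hd := ((hχ.differentiable one_ne_zero x).hasFDerivAt.smul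
        ((huat x hx).differentiableAt one_ne_zero).hasFDerivAt).fderiv
      have hd' : fderiv ℝ U x = χ x • fderiv ℝ u x + (fderiv ℝ χ x).smulRight (u x) := hd
      rw [hd']
      refine (norm_add_le _ _).trans (add_le_add ?_ ?_)
      · rw [norm_smul, Real.norm_eq_abs, abs_of_nonneg (hχ0 x)]
        exact mul_le_of_le_one_left (norm_nonneg _) (hχ1 x)
      · rw [ContinuousLinearMap.norm_smulRight_apply]
        gcongr
        exact hχL x
    have e3 : h x ≤ B * (‖u x‖ + frob (grad u x)) := by
      simp only [hh, hfun]
      have e4 : (1 + L) * ‖U x‖ ≤ (1 + L) * ‖u x‖ := by gcongr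
      have e5 : 1 * frob (grad u x) ≤ B * frob (grad u x) := by gcongr
      simp only [hB] at e5 ⊢
      linarith
    calc h x ^ n ≤ (B * (‖u x‖ + frob (grad u x))) ^ n := by
          have := hh0 x
          gcongr
      _ = B ^ n * (‖u x‖ + frob (grad u x)) ^ n := mul_pow _ _ _
      _ ≤ B ^ n * (2 ^ (n - 1) * (‖u x‖ ^ n + frob (grad u x) ^ n)) := by
          gcongr
          exact add_pow_le hu0 hf0 n
      _ = _ := by ring
  have hhD : ∫⁻ x, ENNReal.ofReal (h x ^ n) ≤ D := by
    have e1 : ∫⁻ x, ENNReal.ofReal (h x ^ n) = ∫⁻ x in Ω, ENNReal.ofReal (h x ^ n) := by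
      rw [← lintegral_indicator hΩo.measurableSet]
      refine lintegral_congr fun x => ?_
      by_cases hx : x ∈ Ω
      · rw [Set.indicator_of_mem hx]
      · rw [Set.indicator_of_notMem hx, hh, hfun_zero L fun h => hx (hχΩ (hUsub h)),
          zero_pow (by omega), ENNReal.ofReal_zero]
    rw [e1]
    calc _ ≤ ∫⁻ x in Ω, ENNReal.ofReal (B ^ n * 2 ^ (n - 1)) *
          ENNReal.ofReal (‖u x‖ ^ n + frob (grad u x) ^ n) := by
          refine setLIntegral_mono' hΩo.measurableSet fun x hx => ?_
          rw [← ENNReal.ofReal_mul (by positivity)]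
          exact ENNReal.ofReal_le_ofReal (hhu x hx)
      _ = ENNReal.ofReal (B ^ n * 2 ^ (n - 1)) *
          ∫⁻ x in Ω, ENNReal.ofReal (‖u x‖ ^ n + frob (grad u x) ^ n) :=
          lintegral_const_mul' _ _ ENNReal.ofReal_ne_top
      _ ≤ D := mul_le_mul_right hIntBd _
  have hVX : ∫⁻ x, ENNReal.ofReal (vMax h x ^ n) ≤ X :=
    (vMax_strong hn hmh hh0 hS).trans (mul_le_mul_right hhD _)
  have hUY : ∫⁻ x, ENNReal.ofReal (‖U x‖ ^ (2 * n)) ≤ Y := by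
    refine (hK U hU (hUsub.trans hχΩ)).trans ?_
    simp only [hY]
    gcongr
    refine (lintegral_mono fun x => ENNReal.ofReal_le_ofReal ?_).trans hhD
    have := hUh x
    gcongr
  have hmain := log_ineq hn1 hU hUs hφ hφ0 hφ1 hL hφL hdet
  calc _ ≤ ∫⁻ x in ω, (ENNReal.ofReal (Real.log (2 + n.factorial) * n.factorial) *
        ENNReal.ofReal (vMax h x ^ n) + ENNReal.ofReal n * (ENNReal.ofReal (φ x * (fderiv ℝ U x).det) *
          ENNReal.ofReal (Real.posLog (vMax h x)))) := by
        refine setLIntegral_mono' hω.isClosed.measurableSet fun x hx => ?_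
        have hφx : φ x = 1 := hφω.self_of_nhdsSet x hx
        have hxs : x ∈ tsupport φ := subset_tsupport φ (by simp [hφx])
        have h0 : 0 ≤ (fderiv ℝ U x).det := by
          have := hdet x
          rwa [hφx, one_mul] at this
        rw [grad_det, ← hUu x hxs, hφx, one_mul]
        have a1 := hV0 x
        have a2 : 0 ≤ Real.posLog (vMax h x) := Real.posLog_nonneg
        have a3 : 0 ≤ Real.log (2 + n.factorial) := by
          apply Real.log_nonneg
          have : (0:ℝ) ≤ n.factorial := by positivity
          linarith
        rw [← ENNReal.ofReal_mul h0, ← ENNReal.ofReal_mul (by positivity),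
          ← ENNReal.ofReal_mul (by positivity), ← ENNReal.ofReal_add (by positivity) (by positivity)]
        refine ENNReal.ofReal_le_ofReal (log_bound h0 a1 ?_)
        refine (le_abs_self _).trans ((det_bound hn1 _).trans ?_)
        have := (hUh x).trans (le_vMax h x)
        gcongr
    _ ≤ ∫⁻ x, (ENNReal.ofReal (Real.log (2 + n.factorial) * n.factorial) *
        ENNReal.ofReal (vMax h x ^ n) + ENNReal.ofReal n * (ENNReal.ofReal (φ x * (fderiv ℝ U x).det) *
          ENNReal.ofReal (Real.posLog (vMax h x)))) := setLIntegral_le_lintegral _ _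
    _ = ENNReal.ofReal (Real.log (2 + n.factorial) * n.factorial) *
        (∫⁻ x, ENNReal.ofReal (vMax h x ^ n)) + ENNReal.ofReal n *
          ∫⁻ x, (ENNReal.ofReal (φ x * (fderiv ℝ U x).det) *
          ENNReal.ofReal (Real.posLog (vMax h x))) := by
        rw [lintegral_add_left, lintegral_const_mul' _ _ ENNReal.ofReal_ne_top,
          lintegral_const_mul' _ _ ENNReal.ofReal_ne_top]
        exact (hmV.pow_const n).ennreal_ofReal.const_mul _
    _ ≤ T := by
        simp only [hT]
        gcongr
        refine hmain.trans ?_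
        gcongr
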